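/- arXiv:1002.1126 — 5 statements merged into one kernel-verified Lean document; each statement's English description precedes it below -/
import Mathlib

section
/- Let n ≥ 2 and α ≥ 1 be integers, and let s be a real number with s > s_{α,n}, where s_{α,n} = n/2 − 1 if α = 1, s_{α,n} = n/2 − 3/4 − 1/(4(n−1)) if α = 2, and s_{α,n} = n/2 − 2/α if α ≥ 3. Then there exist b ∈ (0, 1/2) and C > 0 such that for every choice of signs ε₁,…,ε_{α+1} ∈ {−1, +1} and all measurable functions f₁,…,f_{α+1} : ℤ^n × ℝ → [0,∞): Σ_{k ∈ ℤ^n} ∫_ℝ ⟨k⟩^{2s} ⟨τ + |k|²⟩^{−2b} ( Σ_{k₁+⋯+k_{α+1} = k} ∫_{τ₁+⋯+τ_{α+1} = τ} ∏_{i=1}^{α+1} ⟨k_i⟩^{−s} ⟨τ_i + ε_i |k_i|²⟩^{−b} f_i(k_i, τ_i) )² dτ ≤ C ∏_{i=1}^{α+1} ( Σ_{k ∈ ℤ^n} ∫_ℝ f_i(k,τ)² dτ ). -/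
open MeasureTheory

/-- Japanese bracket `⟨y⟩ = (1 + y²)^{1/2}`. -/
noncomputable def jb (y : ℝ) : ℝ := Real.sqrt (1 + y ^ 2)

/-- `|k|²` for `k ∈ ℤⁿ`. -/
noncomputable def zn2 {n : ℕ} (k : Fin n → ℤ) : ℝ := ∑ j, ((k j : ℝ)) ^ 2

/-- `⟨k⟩ = (1 + |k|²)^{1/2}` for `k ∈ ℤⁿ`. -/
noncomputable def jbk {n : ℕ} (k : Fin n → ℤ) : ℝ := Real.sqrt (1 + zn2 k)

/-- The threshold exponent `s_{α,n}` of Proposition 12. -/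
noncomputable def salphan (α n : ℕ) : ℝ :=
  if α = 1 then (n : ℝ) / 2 - 1
  else if α = 2 then (n : ℝ) / 2 - 3 / 4 - 1 / (4 * ((n : ℝ) - 1))
  else (n : ℝ) / 2 - 2 / (α : ℝ)

open scoped ENNReal

lemma succ_le_const_mul_rpow {η : ℝ} (hη : 0 < η) :
    ∃ K : ℝ, 1 ≤ K ∧ ∀ x : ℝ, 2 ≤ x → ∀ e : ℕ, (e : ℝ) + 1 ≤ K * x ^ (η * e) := by
  have hl : 0 < Real.log 2 := Real.log_pos (by norm_num)
  have hm : 0 < η * Real.log 2 := mul_pos hη hl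
  refine ⟨1 + 1 / (η * Real.log 2), by simp; positivity, fun x hx e => ?_⟩
  have h1 : (2 : ℝ) ^ (η * e) ≤ x ^ (η * e) :=
    Real.rpow_le_rpow (by norm_num) hx (by positivity)
  have h2 : 1 + η * Real.log 2 * e ≤ (2 : ℝ) ^ (η * e) := by
    rw [Real.rpow_def_of_pos (by norm_num)]
    have := Real.add_one_le_exp (Real.log 2 * (η * e))
    linarith
  have h3 : (1 + 1 / (η * Real.log 2)) * (1 + η * Real.log 2 * e) =
      1 + e + (1 / (η * Real.log 2) + η * Real.log 2 * e) := by
    field_simp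
    ring
  calc (e : ℝ) + 1 ≤ (1 + 1 / (η * Real.log 2)) * (1 + η * Real.log 2 * e) := by
        rw [h3]
        have : 0 ≤ 1 / (η * Real.log 2) + η * Real.log 2 * e := by positivity
        linarith
    _ ≤ _ := by
        gcongr
        exact h2.trans h1

lemma succ_le_rpow_of_large {η x : ℝ} (hη : 0 < η) (hx : (2 : ℝ) ^ (1 / η) ≤ x) (e : ℕ) :
    (e : ℝ) + 1 ≤ x ^ (η * e) := by
  have h1 : ((2 : ℝ) ^ (1 / η)) ^ (η * e) ≤ x ^ (η * e) :=
    Real.rpow_le_rpow (by positivity) hx (by positivity)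
  rw [← Real.rpow_mul (by norm_num)] at h1
  have h2 : 1 / η * (η * e) = e := by field_simp
  rw [h2, Real.rpow_natCast] at h1
  refine le_trans ?_ h1
  exact_mod_cast Nat.lt_two_pow_self (n := e)

lemma GaussianInt.norm_eq_sq_add_sq (z : GaussianInt) : z.norm = z.re ^ 2 + z.im ^ 2 := by
  rw [Zsqrtd.norm_def]; ring

lemma GaussianInt.finite_norm_le (X : ℝ) : {z : GaussianInt | (z.norm : ℝ) ≤ X}.Finite := by
  have hfin : ((Set.Icc (-⌈X⌉) ⌈X⌉) ×ˢ (Set.Icc (-⌈X⌉) ⌈X⌉)).Finite :=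
    (Set.finite_Icc _ _).prod (Set.finite_Icc _ _)
  refine Set.Finite.of_finite_image (f := fun z : GaussianInt => (z.re, z.im))
    (hfin.subset ?_) ?_
  · rintro _ ⟨z, hz, rfl⟩
    have h1 : z.norm ≤ ⌈X⌉ := by exact_mod_cast (show (z.norm : ℝ) ≤ X from hz).trans (Int.le_ceil X)
    rw [GaussianInt.norm_eq_sq_add_sq] at h1
    simp only [Set.mem_prod, Set.mem_Icc]
    have ha := Int.le_self_sq z.re
    have ha' := Int.le_self_sq (-z.re)
    have hb := Int.le_self_sq z.im
    have hb' := Int.le_self_sq (-z.im)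
    have hc := sq_nonneg z.re
    have hd := sq_nonneg z.im
    simp only [neg_sq] at ha' hb'
    refine ⟨⟨?_, ?_⟩, ?_, ?_⟩ <;> linarith
  · intro z _ w _ h
    simp only [Prod.mk.injEq] at h
    exact Zsqrtd.ext h.1 h.2

lemma prod_succ_count_le {η : ℝ} (hη : 0 < η) : ∃ C : ℝ, 0 < C ∧
    ∀ S : Multiset GaussianInt, (∀ p ∈ S, Irreducible p) →
      ((∏ p ∈ S.toFinset, (S.count p + 1) : ℕ) : ℝ) ≤ C * (S.prod.norm : ℝ) ^ η := by
  obtain ⟨K, hK1, hK⟩ := succ_le_const_mul_rpow hη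
  set X : ℝ := 2 ^ (1 / η)
  set B := (GaussianInt.finite_norm_le X).toFinset
  refine ⟨K ^ B.card, by positivity, fun S hS => ?_⟩
  have hN : ∀ p ∈ S, (2 : ℝ) ≤ (p.norm : ℝ) := by
    intro p hp
    have h0 : 0 ≤ p.norm := GaussianInt.norm_nonneg p
    have h1 : p.norm ≠ 0 := by
      intro h
      rw [GaussianInt.norm_eq_zero] at h
      exact (hS p hp).ne_zero h
    have h2 : p.norm ≠ 1 := by
      intro h
      refine (hS p hp).not_isUnit (Zsqrtd.norm_eq_one_iff.1 ?_)
      simp [h]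
    exact_mod_cast (by omega : 2 ≤ p.norm)
  have hpt : ∀ p ∈ S.toFinset, ((S.count p + 1 : ℕ) : ℝ) ≤
      (if p ∈ B then K else 1) * (p.norm : ℝ) ^ (η * S.count p) := by
    intro p hp
    rw [Multiset.mem_toFinset] at hp
    push_cast
    split_ifs with h
    · exact hK _ (hN p hp) _
    · rw [one_mul]
      refine succ_le_rpow_of_large hη ?_ _
      simp only [B, Set.Finite.mem_toFinset, Set.mem_ofPred_eq, not_le] at h
      exact h.le
  push_cast at hpt ⊢
  refine (Finset.prod_le_prod (fun p _ => by positivity) hpt).trans ?_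
  rw [Finset.prod_mul_distrib]
  have h1 : ∏ p ∈ S.toFinset, (if p ∈ B then K else 1) ≤ K ^ B.card := by
    rw [Finset.prod_ite, Finset.prod_const, Finset.prod_const_one, mul_one]
    refine pow_le_pow_right₀ hK1 (Finset.card_le_card ?_)
    intro p hp
    exact (Finset.mem_filter.1 hp).2
  have h2 : ∏ p ∈ S.toFinset, (p.norm : ℝ) ^ (η * S.count p) = (S.prod.norm : ℝ) ^ η := by
    have h3 : S.prod.norm = (S.map Zsqrtd.normMonoidHom).prod := by
      rw [Multiset.prod_hom]; rfl
    rw [h3, Finset.prod_multiset_map_count]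
    push_cast
    rw [← Real.finsetProd_rpow]
    · refine Finset.prod_congr rfl fun p hp => ?_
      rw [mul_comm, Real.rpow_mul (by exact_mod_cast GaussianInt.norm_nonneg p), Real.rpow_natCast]
      rfl
    · intro p _
      have : (0 : ℝ) ≤ (p.norm : ℝ) := by exact_mod_cast GaussianInt.norm_nonneg p
      exact pow_nonneg this _
  rw [h2]
  gcongr
  exact Real.rpow_nonneg (by exact_mod_cast GaussianInt.norm_nonneg _) _

lemma GaussianInt.card_le_of_norm_eq {η : ℝ} (hη : 0 < η) : ∃ C : ℝ, 0 < C ∧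
    ∀ D : ℤ, 1 ≤ D → ∀ S : Finset GaussianInt, (∀ z ∈ S, z.norm = D) →
      (S.card : ℝ) ≤ C * (D : ℝ) ^ η := by
  classical
  let : StrongNormalizationMonoid GaussianInt :=
    UniqueFactorizationMonoid.strongNormalizationMonoid
  obtain ⟨C, hC, hbd⟩ := prod_succ_count_le (η := η / 2) (by positivity)
  set U := (GaussianInt.finite_norm_le 1).toFinset
  refine ⟨(U.card + 1) * C, by positivity, fun D hD S hS => ?_⟩
  have hD0 : (D : GaussianInt) ≠ 0 := by
    exact_mod_cast (by omega : D ≠ 0)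
  have hz0 : ∀ z ∈ S, z ≠ 0 := by
    rintro z hz rfl
    have := hS 0 hz
    simp at this
    omega
  set F := UniqueFactorizationMonoid.normalizedFactors (D : GaussianInt)
  have hmaps : ∀ z ∈ S, UniqueFactorizationMonoid.normalizedFactors z ∈ Finset.Iic F := by
    intro z hz
    rw [Finset.mem_Iic,
      ← UniqueFactorizationMonoid.dvd_iff_normalizedFactors_le_normalizedFactors (hz0 z hz) hD0]
    refine ⟨star z, ?_⟩
    rw [← Zsqrtd.norm_eq_mul_conj, hS z hz]
  have hfib : ∀ m ∈ Finset.Iic F,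
      (S.filter fun z => UniqueFactorizationMonoid.normalizedFactors z = m).card ≤ U.card + 1 := by
    intro m _
    by_cases hne : (S.filter fun z =>
        UniqueFactorizationMonoid.normalizedFactors z = m).Nonempty
    · obtain ⟨w, hw⟩ := hne
      rw [Finset.mem_filter] at hw
      refine (Finset.card_le_card (t := U.image (fun u => w * u)) ?_).trans
        (Finset.card_image_le.trans (Nat.le_succ _))
      intro z hz
      rw [Finset.mem_filter] at hz
      have : Associated w z := by
        rw [UniqueFactorizationMonoid.associated_iff_normalizedFactors_eq_normalizedFactors
          (hz0 w hw.1) (hz0 z hz.1), hw.2, hz.2]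
      obtain ⟨u, rfl⟩ := this
      refine Finset.mem_image.2 ⟨u, ?_, rfl⟩
      simp only [U, Set.Finite.mem_toFinset, Set.mem_ofPred_eq]
      have hu := Zsqrtd.norm_eq_one_iff.2 u.isUnit
      have := GaussianInt.norm_nonneg (u : GaussianInt)
      exact_mod_cast (by omega : (u : GaussianInt).norm ≤ 1)
    · rw [Finset.not_nonempty_iff_eq_empty] at hne
      simp [hne]
  have hcard := Finset.card_le_mul_card_image_of_maps_to hmaps _ hfib
  rw [Multiset.card_Iic] at hcard
  have hF := hbd F (fun p hp => UniqueFactorizationMonoid.irreducible_of_normalized_factor p hp)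
  have hnorm : (F.prod.norm : ℝ) ^ (η / 2) = (D : ℝ) ^ η := by
    have hass := UniqueFactorizationMonoid.prod_normalizedFactors hD0
    have h1 : F.prod.norm = (D : GaussianInt).norm := by
      obtain ⟨u, hu⟩ := hass
      rw [← hu, Zsqrtd.norm_mul]
      have hu := Zsqrtd.norm_eq_one_iff.2 u.isUnit
      have := GaussianInt.norm_nonneg (u : GaussianInt)
      rw [(by omega : (u : GaussianInt).norm = 1), mul_one]
    rw [h1, Zsqrtd.norm_intCast]
    have hD' : (0 : ℝ) ≤ D := by exact_mod_cast (by omega : 0 ≤ D)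
    push_cast
    rw [← pow_two, ← Real.rpow_natCast, ← Real.rpow_mul hD']
    congr 1
    push_cast
    ring
  rw [hnorm] at hF
  calc (S.card : ℝ) ≤ (((U.card + 1) * ∏ p ∈ F.toFinset, (F.count p + 1) : ℕ) : ℝ) := by
        exact_mod_cast hcard
    _ ≤ (U.card + 1) * (C * (D : ℝ) ^ η) := by
        rw [Nat.cast_mul]
        push_cast at hF ⊢
        gcongr
    _ = _ := by ring

lemma sq_norm_le_of_three_points_on_circle {R D a b : ℤ} {p q r : ℤ × ℤ}
    (hp : p.1 ^ 2 + p.2 ^ 2 = D) (hq : q.1 ^ 2 + q.2 ^ 2 = D) (hr : r.1 ^ 2 + r.2 ^ 2 = D)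
    (hpa : |p.1 - a| ≤ R ∧ |p.2 - b| ≤ R) (hqa : |q.1 - a| ≤ R ∧ |q.2 - b| ≤ R)
    (hra : |r.1 - a| ≤ R ∧ |r.2 - b| ≤ R) (hpq : p ≠ q) (hpr : p ≠ r) (hqr : q ≠ r) :
    D ≤ 512 * R ^ 6 := by
  obtain ⟨p1, p2⟩ := p
  obtain ⟨q1, q2⟩ := q
  obtain ⟨r1, r2⟩ := r
  simp only [ne_eq, Prod.mk.injEq] at *
  obtain ⟨u1, rfl⟩ : ∃ u, q1 = p1 + u := ⟨q1 - p1, by ring⟩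
  obtain ⟨u2, rfl⟩ : ∃ u, q2 = p2 + u := ⟨q2 - p2, by ring⟩
  obtain ⟨v1, rfl⟩ : ∃ u, r1 = p1 + u := ⟨r1 - p1, by ring⟩
  obtain ⟨v2, rfl⟩ : ∃ u, r2 = p2 + u := ⟨r2 - p2, by ring⟩
  simp only [abs_le] at hpa hqa hra
  have hR : 0 ≤ R := by linarith
  have hu1 : |u1| ≤ 2 * R := by rw [abs_le]; constructor <;> linarith
  have hu2 : |u2| ≤ 2 * R := by rw [abs_le]; constructor <;> linarith
  have hv1 : |v1| ≤ 2 * R := by rw [abs_le]; constructor <;> linarith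
  have hv2 : |v2| ≤ 2 * R := by rw [abs_le]; constructor <;> linarith
  have hu : 2 * (p1 * u1 + p2 * u2) = -(u1 ^ 2 + u2 ^ 2) := by linarith
  have hv : 2 * (p1 * v1 + p2 * v2) = -(v1 ^ 2 + v2 ^ 2) := by linarith
  have e1 : 2 * p1 * (u1 * v2 - u2 * v1) =
      (v1 ^ 2 + v2 ^ 2) * u2 - (u1 ^ 2 + u2 ^ 2) * v2 := by
    linear_combination v2 * hu - u2 * hv
  have e2 : 2 * p2 * (u1 * v2 - u2 * v1) =
      (u1 ^ 2 + u2 ^ 2) * v1 - (v1 ^ 2 + v2 ^ 2) * u1 := by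
    linear_combination u1 * hv - v1 * hu
  have hU0 : 0 < u1 ^ 2 + u2 ^ 2 := by
    rcases eq_or_ne u1 0 with h | h
    · have : u2 ≠ 0 := by rintro rfl; simp [h] at hpq
      positivity
    · positivity
  have hV0 : 0 < v1 ^ 2 + v2 ^ 2 := by
    rcases eq_or_ne v1 0 with h | h
    · have : v2 ≠ 0 := by rintro rfl; simp [h] at hpr
      positivity
    · positivity
  have hdet : u1 * v2 - u2 * v1 ≠ 0 := by
    intro h
    rw [h, mul_zero] at e1 e2
    have h1 : (u1 ^ 2 + u2 ^ 2) * (v1 ^ 2 + v2 ^ 2) *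
        ((u1 ^ 2 + u2 ^ 2) - (v1 ^ 2 + v2 ^ 2)) = 0 := by
      linear_combination (-(u1 ^ 2 + u2 ^ 2) * v1 - (v1 ^ 2 + v2 ^ 2) * u1) * e2 +
        ((u1 ^ 2 + u2 ^ 2) * v2 + (v1 ^ 2 + v2 ^ 2) * u2) * e1
    have h2 : u1 ^ 2 + u2 ^ 2 = v1 ^ 2 + v2 ^ 2 := by
      rcases mul_eq_zero.1 h1 with h | h
      · exact absurd h (by positivity)
      · linarith
    rw [h2] at e1 e2
    have h3 : u1 = v1 := by
      have : (v1 ^ 2 + v2 ^ 2) * (v1 - u1) = 0 := by linarith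
      rcases mul_eq_zero.1 this with h | h <;> omega
    have h4 : u2 = v2 := by
      have : (v1 ^ 2 + v2 ^ 2) * (v2 - u2) = 0 := by linarith
      rcases mul_eq_zero.1 this with h | h <;> omega
    simp [h3, h4] at hqr
  have hdet1 : 1 ≤ |u1 * v2 - u2 * v1| := Int.one_le_abs hdet
  have sqb : ∀ x : ℤ, |x| ≤ 2 * R → x ^ 2 ≤ 4 * R ^ 2 := by
    intro x hx
    have := pow_le_pow_left₀ (abs_nonneg x) hx 2
    rw [sq_abs] at this
    linarith
  have hU : u1 ^ 2 + u2 ^ 2 ≤ 8 * R ^ 2 := by linarith [sqb _ hu1, sqb _ hu2]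
  have hV : v1 ^ 2 + v2 ^ 2 ≤ 8 * R ^ 2 := by linarith [sqb _ hv1, sqb _ hv2]
  have key : ∀ x A B y z : ℤ, 0 ≤ A → 0 ≤ B → A ≤ 8 * R ^ 2 → B ≤ 8 * R ^ 2 → |y| ≤ 2 * R →
      |z| ≤ 2 * R → 2 * x * (u1 * v2 - u2 * v1) = A * y - B * z → x ^ 2 ≤ 256 * R ^ 6 := by
    intro x A B y z hA0 hB0 hA hB hy hz h
    have h1 : |2 * x * (u1 * v2 - u2 * v1)| ≤ 32 * R ^ 3 := by
      rw [h]
      calc |A * y - B * z| ≤ |A * y| + |B * z| := abs_sub _ _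
        _ = A * |y| + B * |z| := by rw [abs_mul, abs_mul, abs_of_nonneg hA0, abs_of_nonneg hB0]
        _ ≤ 8 * R ^ 2 * (2 * R) + 8 * R ^ 2 * (2 * R) := by gcongr
        _ = _ := by ring
    have h2 : |x| ≤ 16 * R ^ 3 := by
      rw [abs_mul, abs_mul] at h1
      have : |(2 : ℤ)| = 2 := rfl
      rw [this] at h1
      nlinarith [abs_nonneg x]
    have := pow_le_pow_left₀ (abs_nonneg x) h2 2
    rw [sq_abs] at this
    linarith
  have k1 := key p1 _ _ _ _ hV0.le hU0.le hV hU hu2 hv2 e1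
  have k2 := key p2 _ _ _ _ hU0.le hV0.le hU hV hv1 hu1 e2
  linarith

lemma card_circle_inter_box_le {η : ℝ} (hη : 0 < η) : ∃ C : ℝ, 0 < C ∧
    ∀ R : ℕ, 1 ≤ R → ∀ a b D : ℤ, ∀ S : Finset (ℤ × ℤ),
      (∀ p ∈ S, p.1 ^ 2 + p.2 ^ 2 = D ∧ |p.1 - a| ≤ R ∧ |p.2 - b| ≤ R) →
      (S.card : ℝ) ≤ C * (R : ℝ) ^ η := by
  classical
  obtain ⟨C, hC, hbd⟩ := GaussianInt.card_le_of_norm_eq (η := η / 6) (by positivity)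
  refine ⟨2 + C * 512 ^ (η / 6), by positivity, fun R hR a b D S hS => ?_⟩
  have hR1 : (1 : ℝ) ≤ R := by exact_mod_cast hR
  have hRη : 1 ≤ (R : ℝ) ^ η := Real.one_le_rpow hR1 hη.le
  have h512 : 0 < C * (512 : ℝ) ^ (η / 6) := by positivity
  rcases le_or_gt S.card 2 with hcard | hcard
  · have : (S.card : ℝ) ≤ 2 := by exact_mod_cast hcard
    nlinarith
  · obtain ⟨p, q, r, hp, hq, hr, hpq, hpr, hqr⟩ := Finset.two_lt_card_iff.1 hcard
    have hD := sq_norm_le_of_three_points_on_circle (hS p hp).1 (hS q hq).1 (hS r hr).1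
      (hS p hp).2 (hS q hq).2 (hS r hr).2 hpq hpr hqr
    have hD1 : 1 ≤ D := by
      by_contra hlt
      have key : ∀ x ∈ S, x = (0, 0) := by
        intro x hx
        have := (hS x hx).1
        have h1 : x.1 ^ 2 = 0 := by nlinarith [sq_nonneg x.1, sq_nonneg x.2]
        have h2 : x.2 ^ 2 = 0 := by nlinarith [sq_nonneg x.1, sq_nonneg x.2]
        exact Prod.ext (pow_eq_zero_iff (two_ne_zero) |>.1 h1)
          (pow_eq_zero_iff (two_ne_zero) |>.1 h2)
      exact hpq ((key p hp).trans (key q hq).symm)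
    have hinj : Function.Injective (fun x : ℤ × ℤ => (⟨x.1, x.2⟩ : GaussianInt)) := by
      intro x y h
      simp only [Zsqrtd.mk.injEq] at h
      exact Prod.ext h.1 h.2
    have h1 := hbd D hD1 (S.image fun x : ℤ × ℤ => (⟨x.1, x.2⟩ : GaussianInt)) (by
      intro z hz
      obtain ⟨x, hx, rfl⟩ := Finset.mem_image.1 hz
      rw [GaussianInt.norm_eq_sq_add_sq]
      exact (hS x hx).1)
    rw [Finset.card_image_of_injective _ hinj] at h1
    refine h1.trans ?_
    have h2 : (D : ℝ) ^ (η / 6) ≤ 512 ^ (η / 6) * (R : ℝ) ^ η := by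
      have h3 : (D : ℝ) ≤ 512 * (R : ℝ) ^ 6 := by exact_mod_cast hD
      calc (D : ℝ) ^ (η / 6) ≤ (512 * (R : ℝ) ^ 6) ^ (η / 6) :=
            Real.rpow_le_rpow (by exact_mod_cast (by omega : 0 ≤ D)) h3 (by positivity)
        _ = _ := by
            rw [Real.mul_rpow (by norm_num) (by positivity), ← Real.rpow_natCast,
              ← Real.rpow_mul (by positivity)]
            congr 2
            push_cast
            ring
    calc C * (D : ℝ) ^ (η / 6) ≤ C * (512 ^ (η / 6) * (R : ℝ) ^ η) := by gcongr
      _ ≤ _ := by nlinarith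

/-- Lattice points on the sphere `|k - l|² + |l|² = m` with coordinates bounded by `M`. -/
lemma card_sphere_inter_box_le (d : ℕ) {η : ℝ} (hη : 0 < η) : ∃ C : ℝ, 0 < C ∧
    ∀ M : ℕ, 1 ≤ M → ∀ (k : Fin (d + 2) → ℤ) (m : ℤ) (S : Finset (Fin (d + 2) → ℤ)),
      (∀ l ∈ S, ∑ j, ((k j - l j) ^ 2 + l j ^ 2) = m ∧ ∀ j, |l j| ≤ M) →
      (S.card : ℝ) ≤ C * (M : ℝ) ^ (d + η) := by
  classical
  obtain ⟨C, hC, hbd⟩ := card_circle_inter_box_le hη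
  refine ⟨3 ^ d * (C * 2 ^ η), by positivity, fun M hM k m S hS => ?_⟩
  have hM1 : (1 : ℝ) ≤ M := by exact_mod_cast hM
  set T : Finset (Fin d → ℤ) := Fintype.piFinset fun _ => Finset.Icc (-(M : ℤ)) M
  have hmaps : ∀ l ∈ S, (fun j : Fin d => l j.succ.succ) ∈ T := by
    intro l hl
    simp only [T, Fintype.mem_piFinset, Finset.mem_Icc]
    exact fun j => abs_le.1 ((hS l hl).2 _)
  have hfib : ∀ t ∈ T, (S.filter fun l => (fun j : Fin d => l j.succ.succ) = t).card
      ≤ ⌊C * ((2 * M : ℕ) : ℝ) ^ η⌋₊ := by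
    intro t _
    refine Nat.le_floor ?_
    set g : (Fin (d + 2) → ℤ) → ℤ × ℤ := fun l => (2 * l 0 - k 0, 2 * l 1 - k 1)
    have hinj : Set.InjOn g (S.filter fun l => (fun j : Fin d => l j.succ.succ) = t) := by
      intro l hl l' hl' h
      simp only [Finset.coe_filter, Set.mem_ofPred_eq] at hl hl'
      simp only [g, Prod.mk.injEq] at h
      ext j
      refine Fin.cases (by omega) (fun j => ?_) j
      refine Fin.cases (by simp only [Fin.succ_zero_eq_one]; omega) (fun j => ?_) j
      exact congrFun (hl.2.trans hl'.2.symm) j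
    rw [← Finset.card_image_of_injOn hinj]
    refine hbd (2 * M) (by omega) (-k 0) (-k 1) (2 * (m - ∑ j : Fin d,
      ((k j.succ.succ - t j) ^ 2 + t j ^ 2)) - k 0 ^ 2 - k 1 ^ 2) _ ?_
    intro p hp
    obtain ⟨l, hl, rfl⟩ := Finset.mem_image.1 hp
    obtain ⟨hlS, hlt⟩ := Finset.mem_filter.1 hl
    obtain ⟨hsum, hbox⟩ := hS l hlS
    refine ⟨?_, ?_, ?_⟩
    · rw [Fin.sum_univ_succ, Fin.sum_univ_succ] at hsum
      subst hlt
      simp only [g]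
      simp only [Fin.succ_zero_eq_one] at hsum
      rw [← hsum]
      ring
    · have := abs_le.1 (hbox 0)
      simp only [g, abs_le]
      push_cast
      constructor <;> linarith
    · have := abs_le.1 (hbox 1)
      simp only [g, abs_le]
      push_cast
      constructor <;> linarith
  have hcard := Finset.card_le_mul_card_image_of_maps_to hmaps _ hfib
  have hT : (T.card : ℝ) ≤ 3 ^ d * (M : ℝ) ^ d := by
    simp only [T, Fintype.card_piFinset_const, Int.card_Icc]
    rw [← mul_pow]
    push_cast
    have : (((M : ℤ) + 1 - -(M : ℤ)).toNat : ℝ) = 2 * M + 1 := by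
      rw [(by omega : ((M : ℤ) + 1 - -(M : ℤ)).toNat = 2 * M + 1)]
      push_cast
      rfl
    rw [this]
    refine pow_le_pow_left₀ (by positivity) (by linarith) _
  calc (S.card : ℝ) ≤ ((⌊C * ((2 * M : ℕ) : ℝ) ^ η⌋₊ * T.card : ℕ) : ℝ) := by
        exact_mod_cast hcard
    _ ≤ (C * ((2 * M : ℕ) : ℝ) ^ η) * (3 ^ d * (M : ℝ) ^ d) := by
        rw [Nat.cast_mul]
        gcongr
        exact Nat.floor_le (by positivity)
    _ = _ := by
        push_cast
        rw [Real.mul_rpow (by norm_num) (by positivity), Real.rpow_add (by positivity),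
          Real.rpow_natCast]
        ring

/-- The modulation weight `⟨x⟩^{-r}`, valued in `ℝ≥0∞`. -/
noncomputable def modWeight (r x : ℝ) : ℝ≥0∞ := ENNReal.ofReal (jb x ^ (-r))

/-- The frequency weight `⟨k⟩^{-r}`, valued in `ℝ≥0∞`. -/
noncomputable def freqWeight {n : ℕ} (r : ℝ) (k : Fin n → ℤ) : ℝ≥0∞ :=
  ENNReal.ofReal (jbk k ^ (-r))

lemma one_le_jb (x : ℝ) : 1 ≤ jb x := by
  rw [jb, Real.one_le_sqrt]; nlinarith [sq_nonneg x]

lemma jb_pos (x : ℝ) : 0 < jb x := one_pos.trans_le (one_le_jb x)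

lemma jb_neg (x : ℝ) : jb (-x) = jb x := by simp [jb]

lemma zn2_nonneg {n : ℕ} (k : Fin n → ℤ) : 0 ≤ zn2 k := Finset.sum_nonneg fun _ _ => sq_nonneg _

lemma zn2_neg {n : ℕ} (k : Fin n → ℤ) : zn2 (-k) = zn2 k := by simp [zn2]

lemma one_le_jbk {n : ℕ} (k : Fin n → ℤ) : 1 ≤ jbk k := by
  rw [jbk, Real.one_le_sqrt]; linarith [zn2_nonneg k]

lemma jbk_pos {n : ℕ} (k : Fin n → ℤ) : 0 < jbk k := one_pos.trans_le (one_le_jbk k)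

lemma jbk_neg {n : ℕ} (k : Fin n → ℤ) : jbk (-k) = jbk k := by simp [jbk, zn2_neg]

lemma measurable_jb : Measurable jb := by
  unfold jb; fun_prop

lemma measurable_modWeight (r : ℝ) : Measurable (modWeight r) := by
  have := measurable_jb
  unfold modWeight; fun_prop

lemma modWeight_neg (r x : ℝ) : modWeight r (-x) = modWeight r x := by
  simp [modWeight, jb_neg]

lemma freqWeight_neg {n : ℕ} (r : ℝ) (k : Fin n → ℤ) : freqWeight r (-k) = freqWeight r k := by
  simp [freqWeight, jbk_neg]

lemma modWeight_sq (r x : ℝ) : modWeight r x ^ 2 = modWeight (2 * r) x := by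
  have := jb_pos x
  rw [modWeight, modWeight, ← ENNReal.ofReal_pow (by positivity), ← Real.rpow_natCast,
    ← Real.rpow_mul this.le]
  congr 2
  push_cast
  ring

lemma freqWeight_sq {n : ℕ} (r : ℝ) (k : Fin n → ℤ) :
    freqWeight r k ^ 2 = freqWeight (2 * r) k := by
  have := jbk_pos k
  rw [freqWeight, freqWeight, ← ENNReal.ofReal_pow (by positivity), ← Real.rpow_natCast,
    ← Real.rpow_mul this.le]
  congr 2
  push_cast
  ring

lemma jb_add_le {x y : ℝ} (hy : |y| ≤ 1) : jb (x + y) ≤ 2 * jb x := by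
  rw [jb, jb, Real.sqrt_le_left (by positivity), mul_pow, Real.sq_sqrt (by positivity)]
  have := sq_le_one_iff_abs_le_one y |>.2 hy
  nlinarith [sq_nonneg (x - y), sq_nonneg x]

lemma jb_add_le_max (x y : ℝ) : jb (x + y) ≤ 2 * max (jb x) (jb y) := by
  have key : ∀ x y : ℝ, |x| ≤ |y| → jb (x + y) ≤ 2 * jb y := by
    intro x y h
    rw [jb, jb, Real.sqrt_le_left (by positivity), mul_pow, Real.sq_sqrt (by positivity)]
    have := sq_le_sq.2 h
    nlinarith [sq_nonneg (x - y)]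
  rcases le_total |x| |y| with h | h
  · exact (key x y h).trans (by gcongr; exact le_max_right _ _)
  · rw [add_comm]
    exact (key y x h).trans (by gcongr; exact le_max_left _ _)

lemma rpow_neg_le_of_le_two_mul {r x y : ℝ} (hr : 0 ≤ r) (hx : 0 < x) (hy : 0 < y)
    (h : y ≤ 2 * x) : x ^ (-r) ≤ 2 ^ r * y ^ (-r) := by
  have h1 : (2 * x) ^ (-r) ≤ y ^ (-r) := Real.rpow_le_rpow_of_nonpos hy h (by linarith)
  rw [Real.mul_rpow (by norm_num) hx.le, Real.rpow_neg (by norm_num : (0:ℝ) ≤ 2)] at h1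
  have h2 : (0 : ℝ) < 2 ^ r := by positivity
  calc x ^ (-r) = 2 ^ r * ((2 ^ r)⁻¹ * x ^ (-r)) := by field_simp
    _ ≤ _ := by gcongr

lemma lintegral_modWeight_lt_top {r : ℝ} (hr : 1 < r) : ∫⁻ x, modWeight r x < ∞ := by
  have h := integrable_rpow_neg_one_add_norm_sq (E := ℝ) (μ := volume) (r := r) (by simpa using hr)
  have h2 : (fun x : ℝ => (1 + ‖x‖ ^ 2) ^ (-r / 2)) = fun x => jb x ^ (-r) := by
    ext x
    rw [jb, Real.sqrt_eq_rpow, ← Real.rpow_mul (by positivity), Real.norm_eq_abs, sq_abs]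
    congr 1
    ring
  rw [h2] at h
  exact h.lintegral_lt_top

lemma lintegral_modWeight_add_mul (r : ℝ) (a : ℝ) :
    ∫⁻ x, modWeight r (x + a) = ∫⁻ x, modWeight r x :=
  lintegral_add_right_eq_self (fun x => modWeight r x) a

lemma lintegral_modWeight_conv_le {r : ℝ} (hr : 1 < r) : ∃ C : ℝ≥0∞, C ≠ ∞ ∧ ∀ A B : ℝ,
    ∫⁻ t, modWeight r (A - t) * modWeight r (t + B) ≤ C * modWeight r (A + B) := by
  set I := ∫⁻ x, modWeight r x
  have hI : I ≠ ∞ := (lintegral_modWeight_lt_top hr).ne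
  refine ⟨ENNReal.ofReal (2 ^ r) * (I + I), by finiteness, fun A B => ?_⟩
  have hpt : ∀ t, modWeight r (A - t) * modWeight r (t + B) ≤
      ENNReal.ofReal (2 ^ r) * modWeight r (A + B) * (modWeight r (t - A) + modWeight r (t + B)) := by
    intro t
    have e : modWeight r (A - t) = modWeight r (t - A) := by rw [← modWeight_neg]; congr 1; ring
    have hmax := jb_add_le_max (A - t) (t + B)
    rw [(by ring : A - t + (t + B) = A + B)] at hmax
    have hle : ∀ x, jb (A + B) ≤ 2 * jb x →
        modWeight r x ≤ ENNReal.ofReal (2 ^ r) * modWeight r (A + B) := by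
      intro x hx
      rw [modWeight, modWeight, ← ENNReal.ofReal_mul (by positivity)]
      exact ENNReal.ofReal_le_ofReal
        (rpow_neg_le_of_le_two_mul (by linarith) (jb_pos _) (jb_pos _) hx)
    rcases le_total (jb (A - t)) (jb (t + B)) with h | h
    · rw [max_eq_right h] at hmax
      rw [mul_comm (modWeight r (A - t)), e]
      exact mul_le_mul' (hle _ hmax) le_self_add
    · rw [max_eq_left h] at hmax
      exact mul_le_mul' (hle _ hmax) le_add_self
  have hm := measurable_modWeight r
  calc _ ≤ ∫⁻ t, ENNReal.ofReal (2 ^ r) * modWeight r (A + B) *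
          (modWeight r (t - A) + modWeight r (t + B)) := lintegral_mono hpt
    _ = ENNReal.ofReal (2 ^ r) * modWeight r (A + B) * (I + I) := by
        rw [lintegral_const_mul _ (by fun_prop), lintegral_add_left (by fun_prop),
          lintegral_modWeight_add_mul]
        simp_rw [sub_eq_add_neg]
        rw [lintegral_modWeight_add_mul]
    _ = _ := by ring

lemma tsum_modWeight_int_le {r : ℝ} (hr : 1 < r) : ∃ C : ℝ≥0∞, C ≠ ∞ ∧
    ∀ ε : ℝ, ε = 1 ∨ ε = -1 → ∀ τ : ℝ, ∑' m : ℤ, modWeight r (τ + ε * m) ≤ C := by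
  refine ⟨ENNReal.ofReal (2 ^ r) * ∫⁻ x, modWeight r x, ?_, fun ε hε τ => ?_⟩
  · have := (lintegral_modWeight_lt_top hr).ne
    finiteness
  have key : ∑' m : ℤ, modWeight r (τ + m) ≤ ENNReal.ofReal (2 ^ r) * ∫⁻ x, modWeight r x := by
    have hpt : ∀ m : ℤ, modWeight r (τ + m) ≤
        ∫⁻ t in Set.Ico (m : ℝ) (m + 1), ENNReal.ofReal (2 ^ r) * modWeight r (t + τ) := by
      intro m
      calc modWeight r (τ + m) = ∫⁻ t in Set.Ico (m : ℝ) (m + 1), modWeight r (τ + m) := by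
            simp
        _ ≤ _ := by
            refine setLIntegral_mono' measurableSet_Ico fun t ht => ?_
            rw [modWeight, modWeight, ← ENNReal.ofReal_mul (by positivity)]
            refine ENNReal.ofReal_le_ofReal
              (rpow_neg_le_of_le_two_mul (by linarith) (jb_pos _) (jb_pos _) ?_)
            rw [(by ring : t + τ = (τ + m) + (t - m))]
            exact jb_add_le (abs_le.2 ⟨by linarith [ht.1], by linarith [ht.2]⟩)
    refine (ENNReal.tsum_le_tsum hpt).trans (le_of_eq ?_)
    rw [← lintegral_iUnion (fun _ => measurableSet_Ico) (Set.pairwise_disjoint_Ico_intCast ℝ),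
      iUnion_Ico_intCast, setLIntegral_univ, lintegral_const_mul' _ _ ENNReal.ofReal_ne_top,
      lintegral_modWeight_add_mul]
  rcases hε with rfl | rfl
  · simpa using key
  · rw [← (Equiv.neg ℤ).tsum_eq]
    simpa using key

lemma abs_le_jbk {n : ℕ} (k : Fin n → ℤ) (j : Fin n) : |(k j : ℝ)| ≤ jbk k := by
  refine Real.abs_le_sqrt ?_
  have := Finset.single_le_sum (f := fun j => ((k j : ℝ)) ^ 2) (fun _ _ => sq_nonneg _)
    (Finset.mem_univ j)
  simp only [zn2]
  linarith

/-- A dyadic decomposition turns a counting bound into a weighted summation bound. -/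
lemma tsum_freqWeight_le_of_card_le {n : ℕ} {p q C : ℝ} (hpq : q < p) :
    ∃ K : ℝ≥0∞, K ≠ ∞ ∧ ∀ P : (Fin n → ℤ) → Prop, ∀ _ : DecidablePred P,
      (∀ M : ℕ, 1 ≤ M → ∀ S : Finset (Fin n → ℤ), (∀ l ∈ S, P l ∧ ∀ j, |l j| ≤ M) →
        (S.card : ℝ) ≤ C * (M : ℝ) ^ q) →
      ∑' l, (if P l then freqWeight p l else 0) ≤ K := by
  classical
  refine ⟨∑' j : ℕ, ENNReal.ofReal ((2 ^ |p| * C * 2 ^ q) * ((2 : ℝ) ^ (q - p)) ^ j), ?_, ?_⟩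
  · refine Summable.tsum_ofReal_ne_top (Summable.mul_left _ ?_)
    refine summable_geometric_of_lt_one (by positivity) ?_
    exact Real.rpow_lt_one_of_one_lt_of_neg (by norm_num) (by linarith)
  intro P _ hcard
  set box : ℕ → Finset (Fin n → ℤ) := fun j =>
    (Fintype.piFinset fun _ => Finset.Icc (-((2 ^ (j + 1) : ℕ) : ℤ)) ((2 ^ (j + 1) : ℕ) : ℤ)).filter P
  have hpt : ∀ l, (if P l then freqWeight p l else 0) ≤
      ∑' j : ℕ, if l ∈ box j then ENNReal.ofReal (2 ^ |p| * (2 : ℝ) ^ (-(p * j))) else 0 := by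
    intro l
    split_ifs with hl
    · obtain ⟨j, hj1, hj2⟩ := exists_nat_pow_near (one_le_jbk l) (by norm_num : (1 : ℝ) < 2)
      refine le_trans ?_ (ENNReal.le_tsum j)
      have hmem : l ∈ box j := by
        simp only [box, Finset.mem_filter, Fintype.mem_piFinset, Finset.mem_Icc]
        refine ⟨fun i => abs_le.1 ?_, hl⟩
        have h := (abs_le_jbk l i).trans hj2.le
        exact_mod_cast h
      rw [if_pos hmem]
      refine ENNReal.ofReal_le_ofReal ?_
      have h2j : (0 : ℝ) < 2 ^ j := by positivity
      have e : (2 : ℝ) ^ (-(p * j)) = ((2 : ℝ) ^ j) ^ (-p) := by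
        rw [← Real.rpow_natCast, ← Real.rpow_mul (by norm_num)]
        congr 1
        ring
      rw [e]
      have h2p : 1 ≤ (2 : ℝ) ^ |p| := Real.one_le_rpow (by norm_num) (abs_nonneg p)
      rcases le_total 0 p with hp | hp
      · calc jbk l ^ (-p) ≤ ((2 : ℝ) ^ j) ^ (-p) :=
              Real.rpow_le_rpow_of_nonpos h2j hj1 (by linarith)
          _ ≤ _ := le_mul_of_one_le_left (by positivity) h2p
      · calc jbk l ^ (-p) ≤ ((2 : ℝ) ^ (j + 1)) ^ (-p) :=
              Real.rpow_le_rpow (jbk_pos l).le hj2.le (by linarith)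
          _ = _ := by
            rw [pow_succ, Real.mul_rpow (by positivity) (by positivity), abs_of_nonpos hp, mul_comm]
    · exact zero_le
  refine (ENNReal.tsum_le_tsum hpt).trans ?_
  rw [ENNReal.tsum_comm]
  refine ENNReal.tsum_le_tsum fun j => ?_
  rw [tsum_eq_sum (s := box j) (fun l hl => if_neg hl), Finset.sum_ite_mem, Finset.inter_self,
    Finset.sum_const, nsmul_eq_mul]
  have hc := hcard (2 ^ (j + 1)) Nat.one_le_two_pow (box j) (by
    intro l hl
    simp only [box, Finset.mem_filter, Fintype.mem_piFinset, Finset.mem_Icc] at hl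
    exact ⟨hl.2, fun i => abs_le.2 (hl.1 i)⟩)
  rw [← ENNReal.ofReal_natCast, ← ENNReal.ofReal_mul (by positivity)]
  refine ENNReal.ofReal_le_ofReal ?_
  calc ((box j).card : ℝ) * (2 ^ |p| * (2 : ℝ) ^ (-(p * j)))
      ≤ (C * ((2 ^ (j + 1) : ℕ) : ℝ) ^ q) * (2 ^ |p| * (2 : ℝ) ^ (-(p * j))) := by gcongr
    _ = (2 ^ |p| * C * 2 ^ q) * ((2 : ℝ) ^ (q - p)) ^ j := by
      push_cast
      rw [pow_succ, Real.mul_rpow (by positivity) (by positivity), ← Real.rpow_natCast 2 j,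
        ← Real.rpow_natCast _ j, ← Real.rpow_mul (by norm_num), ← Real.rpow_mul (by norm_num)]
      have : (2 : ℝ) ^ ((q - p) * j) = 2 ^ ((j : ℝ) * q) * 2 ^ (-(p * j)) := by
        rw [← Real.rpow_add (by norm_num)]
        congr 1
        ring
      rw [this]
      ring

lemma tsum_freqWeight_ne_top {n : ℕ} {p : ℝ} (hp : (n : ℝ) < p) :
    ∑' l : Fin n → ℤ, freqWeight p l ≠ ∞ := by
  obtain ⟨K, hK, h⟩ := tsum_freqWeight_le_of_card_le (n := n) (C := 3 ^ n) hp
  have := h (fun _ => True) inferInstance ?_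
  · simp only [if_true] at this
    exact ne_top_of_le_ne_top hK this
  · intro M hM S hS
    have hsub : S ⊆ Fintype.piFinset fun _ => Finset.Icc (-(M : ℤ)) M := by
      intro l hl
      simp only [Fintype.mem_piFinset, Finset.mem_Icc]
      exact fun j => abs_le.1 ((hS l hl).2 j)
    have hc := Finset.card_le_card hsub
    rw [Fintype.card_piFinset_const, Int.card_Icc,
      (by omega : ((M : ℤ) + 1 - -(M : ℤ)).toNat = 2 * M + 1)] at hc
    have hM1 : (1 : ℝ) ≤ M := by exact_mod_cast hM
    calc (S.card : ℝ) ≤ (2 * M + 1) ^ n := by exact_mod_cast hc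
      _ ≤ (3 * M) ^ n := pow_le_pow_left₀ (by positivity) (by linarith) _
      _ = _ := by rw [mul_pow, Real.rpow_natCast]

lemma tsum_freqWeight_sphere_le {d : ℕ} {p : ℝ} (hp : (d : ℝ) < p) : ∃ K : ℝ≥0∞, K ≠ ∞ ∧
    ∀ (k : Fin (d + 2) → ℤ) (m : ℤ),
      ∑' l, (if ∑ j, ((k j - l j) ^ 2 + l j ^ 2) = m then freqWeight p l else 0) ≤ K := by
  obtain ⟨C, hC, h⟩ := card_sphere_inter_box_le d (η := (p - d) / 2) (by linarith)
  obtain ⟨K, hK, hsum⟩ := tsum_freqWeight_le_of_card_le (n := d + 2)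
    (by linarith : (d : ℝ) + (p - d) / 2 < p)
  exact ⟨K, hK, fun k m => hsum _ inferInstance fun M hM S hS => h M hM k m S hS⟩

/-- The kernel bound behind the bilinear `L²` estimate for equal signs. -/
lemma tsum_lintegral_kernel_le {d : ℕ} {p r : ℝ} (hp : (d : ℝ) < p) (hr : 1 < r) :
    ∃ C : ℝ≥0∞, C ≠ ∞ ∧ ∀ ε : ℝ, ε = 1 ∨ ε = -1 → ∀ (k : Fin (d + 2) → ℤ) (τ : ℝ),
      ∑' l, ∫⁻ t, modWeight r ((τ - t) + ε * zn2 (k - l)) *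
        (freqWeight p l * modWeight r (t + ε * zn2 l)) ≤ C := by
  obtain ⟨C₁, hC₁, h₁⟩ := lintegral_modWeight_conv_le hr
  obtain ⟨C₂, hC₂, h₂⟩ := tsum_modWeight_int_le hr
  obtain ⟨C₃, hC₃, h₃⟩ := tsum_freqWeight_sphere_le hp
  refine ⟨C₁ * (C₂ * C₃), by finiteness, fun ε hε k τ => ?_⟩
  have hl : ∀ l, ∫⁻ t, modWeight r ((τ - t) + ε * zn2 (k - l)) *
        (freqWeight p l * modWeight r (t + ε * zn2 l)) ≤
      C₁ * ∑' m : ℤ, modWeight r (τ + ε * m) *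
        (if ∑ j, ((k j - l j) ^ 2 + l j ^ 2) = m then freqWeight p l else 0) := by
    intro l
    calc _ = ∫⁻ t, freqWeight p l * (modWeight r ((τ + ε * zn2 (k - l)) - t) *
            modWeight r (t + ε * zn2 l)) := by
          refine lintegral_congr fun t => ?_
          rw [(by ring : (τ - t) + ε * zn2 (k - l) = (τ + ε * zn2 (k - l)) - t)]
          ring
      _ = freqWeight p l * ∫⁻ t, (modWeight r ((τ + ε * zn2 (k - l)) - t) *
            modWeight r (t + ε * zn2 l)) := lintegral_const_mul' _ _ ENNReal.ofReal_ne_top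
      _ ≤ freqWeight p l * (C₁ * modWeight r (τ + ε * zn2 (k - l) + ε * zn2 l)) := by
          gcongr
          exact h₁ _ _
      _ = C₁ * (modWeight r (τ + ε * ((∑ j, ((k j - l j) ^ 2 + l j ^ 2) : ℤ) : ℝ)) *
            freqWeight p l) := by
          have : ((∑ j, ((k j - l j) ^ 2 + l j ^ 2) : ℤ) : ℝ) = zn2 (k - l) + zn2 l := by
            simp [zn2, Finset.sum_add_distrib]
          rw [this, mul_add, ← add_assoc]
          ring
      _ ≤ _ := by
          gcongr
          refine le_trans (le_of_eq ?_) (ENNReal.le_tsum (∑ j, ((k j - l j) ^ 2 + l j ^ 2)))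
          rw [if_pos rfl]
  refine (ENNReal.tsum_le_tsum hl).trans ?_
  rw [ENNReal.tsum_mul_left, ENNReal.tsum_comm]
  gcongr
  calc _ ≤ ∑' m : ℤ, modWeight r (τ + ε * m) * C₃ := by
        refine ENNReal.tsum_le_tsum fun m => ?_
        rw [ENNReal.tsum_mul_left]
        gcongr
        exact h₃ k m
    _ ≤ _ := by
        rw [ENNReal.tsum_mul_right]
        gcongr
        exact h₂ ε hε τ

/-- The `L²` norm of a nonnegative function. -/
noncomputable def l2norm {X : Type*} [MeasurableSpace X] (μ : Measure X) (f : X → ℝ≥0∞) : ℝ≥0∞ :=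
  (∫⁻ x, f x ^ 2 ∂μ) ^ (1 / 2 : ℝ)

section L2

variable {X : Type*} [MeasurableSpace X] {μ : Measure X}

lemma l2norm_sq (f : X → ℝ≥0∞) : l2norm μ f ^ 2 = ∫⁻ x, f x ^ 2 ∂μ := by
  rw [l2norm, ← ENNReal.rpow_natCast, ← ENNReal.rpow_mul]
  norm_num

lemma l2norm_le_iff {f : X → ℝ≥0∞} {M : ℝ≥0∞} : l2norm μ f ≤ M ↔ ∫⁻ x, f x ^ 2 ∂μ ≤ M ^ 2 := by
  rw [← l2norm_sq, ENNReal.pow_le_pow_left_iff two_ne_zero]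

lemma lintegral_mul_le_l2norm {f g : X → ℝ≥0∞} (hf : Measurable f) (hg : Measurable g) :
    ∫⁻ x, f x * g x ∂μ ≤ l2norm μ f * l2norm μ g := by
  have := ENNReal.lintegral_mul_le_Lp_mul_Lq μ Real.HolderConjugate.two_two hf.aemeasurable
    hg.aemeasurable
  simpa [l2norm] using this

/-- A nonnegative function whose pairing with every function is bounded by the `L²` norm is
bounded in `L²`. -/
lemma l2norm_le_of_forall_lintegral_mul_le [SigmaFinite μ] {T : X → ℝ≥0∞} (hT : Measurable T)
    {M : ℝ≥0∞} (h : ∀ v : X → ℝ≥0∞, Measurable v → ∫⁻ x, v x * T x ∂μ ≤ M * l2norm μ v) :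
    l2norm μ T ≤ M := by
  set v : ℕ → X → ℝ≥0∞ := fun m => (spanningSets μ m).indicator fun x => min (T x) m
  have hv : ∀ m, Measurable (v m) := fun m =>
    (hT.min measurable_const).indicator (measurableSet_spanningSets μ m)
  have hvT : ∀ m x, v m x ≤ T x := fun m x => by
    simp only [v, Set.indicator]
    split_ifs
    · exact min_le_left _ _
    · exact zero_le
  have hmono : Monotone v := by
    intro i j hij x
    simp only [v, Set.indicator]
    split_ifs with h1 h2 h2
    · gcongr
    · exact absurd (monotone_spanningSets μ hij h1) h2
    · exact zero_le
    · exact le_rfl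
  have hsup : ∀ x, ⨆ m, v m x ^ 2 = T x ^ 2 := by
    intro x
    have ht : Filter.Tendsto (fun m => v m x) Filter.atTop (nhds (T x)) := by
      have h1 : Filter.Tendsto (fun m : ℕ => min (T x) (m : ℝ≥0∞)) Filter.atTop
          (nhds (min (T x) ∞)) := tendsto_const_nhds.min ENNReal.tendsto_nat_nhds_top
      rw [min_eq_left le_top] at h1
      refine h1.congr' ?_
      filter_upwards [Filter.eventually_ge_atTop (spanningSetsIndex μ x)] with m hm
      have : x ∈ spanningSets μ m :=
        monotone_spanningSets μ hm (mem_spanningSetsIndex μ x)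
      simp [v, this]
    have ht2 : Filter.Tendsto (fun m => v m x ^ 2) Filter.atTop (nhds (T x ^ 2)) :=
      ((ENNReal.continuous_pow 2).tendsto _).comp ht
    exact iSup_eq_of_tendsto (fun i j hij => by gcongr; exact hmono hij x) ht2
  have hfin : ∀ m, l2norm μ (v m) ≠ ∞ := by
    intro m
    refine ENNReal.rpow_ne_top_of_nonneg (by norm_num) (ne_top_of_le_ne_top ?_
      (lintegral_mono (g := (spanningSets μ m).indicator fun _ => (m : ℝ≥0∞) ^ 2) fun x => ?_))
    · rw [lintegral_indicator (measurableSet_spanningSets μ m), setLIntegral_const]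
      have := measure_spanningSets_lt_top μ m
      finiteness
    · simp only [v, Set.indicator]
      split_ifs
      · gcongr; exact min_le_right _ _
      · simp
  have hb : ∀ m, l2norm μ (v m) ≤ M := by
    intro m
    by_cases h0 : l2norm μ (v m) = 0
    · rw [h0]; exact zero_le
    refine (ENNReal.mul_le_mul_iff_left h0 (hfin m)).1 ?_
    calc l2norm μ (v m) * l2norm μ (v m) = ∫⁻ x, v m x ^ 2 ∂μ := by rw [← sq, l2norm_sq]
      _ ≤ ∫⁻ x, v m x * T x ∂μ := by
        refine lintegral_mono fun x => ?_
        rw [sq]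
        gcongr
        exact hvT m x
      _ ≤ _ := h _ (hv m)
  rw [l2norm_le_iff, ← lintegral_congr hsup,
    lintegral_iSup (fun m => (hv m).pow_const 2) (fun i j hij x => by
      gcongr; exact hmono hij x)]
  exact iSup_le fun m => l2norm_le_iff.1 (hb m)

end L2

lemma l2norm_comp_add_right {G : Type*} [AddCommGroup G] [MeasurableSpace G] [MeasurableAdd₂ G]
    {μ : Measure G} [μ.IsAddLeftInvariant] (f : G → ℝ≥0∞) (y : G) :
    l2norm μ (fun x => f (x + y)) = l2norm μ f := by
  rw [l2norm, l2norm, lintegral_add_right_eq_self (fun x => f x ^ 2) y]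

section Convolution

variable {G : Type*} [AddCommGroup G] [MeasurableSpace G] [MeasurableAdd₂ G] [MeasurableNeg G]
  {μ : Measure G} [SFinite μ] [μ.IsAddLeftInvariant]

/-- The weighted Young-type inequality: a bound on the convolution of the squared weights bounds
the convolution in `L²`. -/
lemma l2norm_conv_le {w₁ w₂ f g : G → ℝ≥0∞} (hw₁ : Measurable w₁) (hw₂ : Measurable w₂)
    (hf : Measurable f) (hg : Measurable g) {C : ℝ≥0∞}
    (hC : ∀ z, ∫⁻ y, w₁ (z - y) ^ 2 * w₂ y ^ 2 ∂μ ≤ C) :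
    l2norm μ (fun z => ∫⁻ y, (w₁ (z - y) * f (z - y)) * (w₂ y * g y) ∂μ) ≤
      C ^ (1 / 2 : ℝ) * (l2norm μ f * l2norm μ g) := by
  have hms : MeasurableSub₂ G := inferInstance
  have hC2 : (C ^ (1 / 2 : ℝ)) ^ 2 = C := by
    rw [← ENNReal.rpow_natCast, ← ENNReal.rpow_mul]; norm_num
  rw [l2norm_le_iff, mul_pow, mul_pow, l2norm_sq, l2norm_sq, hC2]
  calc ∫⁻ z, (∫⁻ y, (w₁ (z - y) * f (z - y)) * (w₂ y * g y) ∂μ) ^ 2 ∂μ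
      ≤ ∫⁻ z, C * ∫⁻ y, f (z - y) ^ 2 * g y ^ 2 ∂μ ∂μ := by
        refine lintegral_mono fun z => ?_
        have h := lintegral_mul_le_l2norm (μ := μ) (f := fun y => w₁ (z - y) * w₂ y)
          (g := fun y => f (z - y) * g y) (by fun_prop) (by fun_prop)
        calc _ = (∫⁻ y, (w₁ (z - y) * w₂ y) * (f (z - y) * g y) ∂μ) ^ 2 := by
              congr 1
              exact lintegral_congr fun y => by ring
          _ ≤ _ := by
            refine (pow_le_pow_left' h 2).trans ?_
            rw [mul_pow, l2norm_sq, l2norm_sq]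
            simp_rw [mul_pow]
            gcongr
            exact hC z
    _ = C * ∫⁻ y, g y ^ 2 * ∫⁻ z, f (z - y) ^ 2 ∂μ ∂μ := by
        rw [lintegral_const_mul _ (Measurable.lintegral_prod_right' (f := fun p : G × G =>
          f (p.1 - p.2) ^ 2 * g p.2 ^ 2) (by fun_prop)), lintegral_lintegral_swap (by fun_prop)]
        congr 1
        refine lintegral_congr fun y => ?_
        rw [← lintegral_const_mul _ (by fun_prop)]
        exact lintegral_congr fun z => mul_comm _ _
    _ = _ := by
        have h : ∀ y, ∫⁻ z, f (z - y) ^ 2 ∂μ = ∫⁻ z, f z ^ 2 ∂μ := fun y =>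
          lintegral_sub_right_eq_self (fun z => f z ^ 2) y
        simp_rw [h]
        rw [lintegral_mul_const _ (by fun_prop), mul_comm (∫⁻ z, f z ^ 2 ∂μ)]

/-- Reflecting one factor does not change the `L²` norm of a convolution. -/
lemma l2norm_conv_neg [μ.IsNegInvariant] {F H : G → ℝ≥0∞} (hF : Measurable F)
    (hH : Measurable H) :
    l2norm μ (fun z => ∫⁻ y, F (z - y) * H (-y) ∂μ) =
      l2norm μ (fun z => ∫⁻ y, F (z - y) * H y ∂μ) := by
  have expand : ∀ H : G → ℝ≥0∞, Measurable H → ∫⁻ z, (∫⁻ y, F (z - y) * H y ∂μ) ^ 2 ∂μ =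
      ∫⁻ y, ∫⁻ y', (H y * H y') * ∫⁻ z, F (z - y) * F (z - y') ∂μ ∂μ ∂μ := by
    intro H hH
    calc _ = ∫⁻ z, ∫⁻ y, ∫⁻ y', (H y * H y') * (F (z - y) * F (z - y')) ∂μ ∂μ ∂μ := by
          refine lintegral_congr fun z => ?_
          rw [sq, ← lintegral_mul_const _ (by fun_prop)]
          refine lintegral_congr fun y => ?_
          rw [← lintegral_const_mul _ (by fun_prop)]
          exact lintegral_congr fun y' => by ring
      _ = ∫⁻ y, ∫⁻ z, ∫⁻ y', (H y * H y') * (F (z - y) * F (z - y')) ∂μ ∂μ ∂μ := by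
          refine lintegral_lintegral_swap (Measurable.aemeasurable ?_)
          exact Measurable.lintegral_prod_right' (f := fun p : (G × G) × G =>
            (H p.1.2 * H p.2) * (F (p.1.1 - p.1.2) * F (p.1.1 - p.2))) (by fun_prop)
      _ = _ := by
          refine lintegral_congr fun y => ?_
          rw [lintegral_lintegral_swap (by fun_prop)]
          refine lintegral_congr fun y' => ?_
          rw [lintegral_const_mul _ (by fun_prop)]
  have hA : ∀ y y', ∫⁻ z, F (z - -y) * F (z - -y') ∂μ = ∫⁻ z, F (z - y) * F (z - y') ∂μ := by
    intro y y'
    rw [← lintegral_add_right_eq_self (fun z => F (z - y) * F (z - y')) (y + y')]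
    refine lintegral_congr fun z => ?_
    rw [mul_comm]
    congr 2 <;> abel
  unfold l2norm
  congr 1
  rw [expand (fun y => H (-y)) (by fun_prop), expand H hH]
  calc _ = ∫⁻ y, ∫⁻ y', (H (-y) * H (-y')) * ∫⁻ z, F (z - -y) * F (z - -y') ∂μ ∂μ ∂μ := by
        simp_rw [hA]
    _ = ∫⁻ y, ∫⁻ y', (H (-y) * H y') * ∫⁻ z, F (z - -y) * F (z - y') ∂μ ∂μ ∂μ :=
        lintegral_congr fun y => lintegral_neg_eq_self fun y' =>
          (H (-y) * H y') * ∫⁻ z, F (z - -y) * F (z - y') ∂μ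
    _ = _ := lintegral_neg_eq_self fun y => ∫⁻ y', (H y * H y') *
          ∫⁻ z, F (z - y) * F (z - y') ∂μ ∂μ

/-- The trilinear form obtained by testing a product against a function, bounded by pairing two
convolutions. -/
lemma lintegral_triple_le [μ.IsNegInvariant] {V F₀ F₁ F₂ : G → ℝ≥0∞} (hV : Measurable V)
    (hF₀ : Measurable F₀) (hF₁ : Measurable F₁) (hF₂ : Measurable F₂) (y : G) :
    ∫⁻ z₁, ∫⁻ z₂, ∫⁻ z₀, V (z₀ + z₁ + z₂ + y) * (F₀ z₀ * F₁ z₁ * F₂ z₂) ∂μ ∂μ ∂μ ≤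
      l2norm μ (fun z => ∫⁻ x, V (z - x) * F₁ x ∂μ) *
        l2norm μ (fun z => ∫⁻ x, F₀ (z - x) * F₂ x ∂μ) := by
  have e1 : ∀ z₁ z₂, ∫⁻ z₀, V (z₀ + z₁ + z₂ + y) * (F₀ z₀ * F₁ z₁ * F₂ z₂) ∂μ =
      ∫⁻ z, (V (z + y + z₁) * F₁ z₁) * (F₀ (z - z₂) * F₂ z₂) ∂μ := by
    intro z₁ z₂
    rw [← lintegral_sub_right_eq_self _ z₂]
    refine lintegral_congr fun z => ?_
    rw [(by abel : z - z₂ + z₁ + z₂ + y = z + y + z₁)]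
    ring
  calc _ = ∫⁻ z, (∫⁻ x, V (z + y + x) * F₁ x ∂μ) * (∫⁻ x, F₀ (z - x) * F₂ x ∂μ) ∂μ := by
        simp_rw [e1]
        calc _ = ∫⁻ z₁, ∫⁻ z, ∫⁻ z₂, (V (z + y + z₁) * F₁ z₁) * (F₀ (z - z₂) * F₂ z₂) ∂μ ∂μ ∂μ :=
              lintegral_congr fun z₁ => lintegral_lintegral_swap (by fun_prop)
          _ = ∫⁻ z, ∫⁻ z₁, ∫⁻ z₂, (V (z + y + z₁) * F₁ z₁) * (F₀ (z - z₂) * F₂ z₂) ∂μ ∂μ ∂μ := by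
              refine lintegral_lintegral_swap (Measurable.aemeasurable ?_)
              exact Measurable.lintegral_prod_right' (f := fun p : (G × G) × G =>
                (V (p.1.2 + y + p.1.1) * F₁ p.1.1) * (F₀ (p.1.2 - p.2) * F₂ p.2)) (by fun_prop)
          _ = _ := by
              refine lintegral_congr fun z => ?_
              rw [← lintegral_mul_const _ (by fun_prop)]
              refine lintegral_congr fun z₁ => ?_
              rw [lintegral_const_mul _ (by fun_prop)]
    _ ≤ l2norm μ (fun z => ∫⁻ x, V (z + y + x) * F₁ x ∂μ) *
        l2norm μ (fun z => ∫⁻ x, F₀ (z - x) * F₂ x ∂μ) := by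
        refine lintegral_mul_le_l2norm ?_ ?_
        · exact Measurable.lintegral_prod_right' (f := fun p : G × G =>
            V (p.1 + y + p.2) * F₁ p.2) (by fun_prop)
        · exact Measurable.lintegral_prod_right' (f := fun p : G × G =>
            F₀ (p.1 - p.2) * F₂ p.2) (by fun_prop)
    _ = _ := by
        congr 1
        rw [l2norm_comp_add_right (fun z => ∫⁻ x, V (z + x) * F₁ x ∂μ) y,
          ← l2norm_conv_neg hV hF₁]
        congr 1
        ext z
        rw [← lintegral_neg_eq_self fun x => V (z + x) * F₁ x]
        simp only [sub_eq_add_neg]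

end Convolution

instance Measure.prod_isNegInvariant {G H : Type*} [MeasurableSpace G] [MeasurableSpace H]
    [InvolutiveNeg G] [InvolutiveNeg H] [MeasurableNeg G] [MeasurableNeg H] (μ : Measure G)
    (ν : Measure H) [SFinite μ] [SFinite ν] [μ.IsNegInvariant] [ν.IsNegInvariant] :
    (μ.prod ν).IsNegInvariant where
  neg_eq_self := ((Measure.measurePreserving_neg μ).prod (Measure.measurePreserving_neg ν)).map_eq

/-- The product of counting measure on `ℤⁿ` and Lebesgue measure on `ℝ`. -/
noncomputable abbrev freqMeasure (n : ℕ) : Measure ((Fin n → ℤ) × ℝ) :=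
  (Measure.count : Measure (Fin n → ℤ)).prod volume

/-- The modulation `τ + ε|k|²` of a space-time frequency. -/
noncomputable def modulation {n : ℕ} (ε : ℝ) (z : (Fin n → ℤ) × ℝ) : ℝ := z.2 + ε * zn2 z.1

lemma measurable_modulation {n : ℕ} (ε : ℝ) : Measurable (modulation (n := n) ε) := by
  have : Measurable (zn2 : (Fin n → ℤ) → ℝ) := Measurable.of_discrete
  unfold modulation
  fun_prop

lemma modulation_neg {n : ℕ} (ε : ℝ) (z : (Fin n → ℤ) × ℝ) :
    modulation ε (-z) = -modulation (-ε) z := by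
  simp only [modulation, Prod.snd_neg, Prod.fst_neg, zn2_neg]
  ring

lemma measurable_freqWeight {n : ℕ} (r : ℝ) : Measurable (freqWeight (n := n) r) :=
  Measurable.of_discrete

lemma lintegral_freqMeasure {n : ℕ} {f : (Fin n → ℤ) × ℝ → ℝ≥0∞} (hf : Measurable f) :
    ∫⁻ z, f z ∂freqMeasure n = ∑' k, ∫⁻ τ, f (k, τ) := by
  rw [lintegral_prod _ hf.aemeasurable, lintegral_count]

/-- The bilinear `L²` estimate, for arbitrary signs. -/
lemma l2norm_bilinear_le {d : ℕ} {a b : ℝ} (ha : (d : ℝ) / 2 < a) (hb : 1 / 2 < b) :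
    ∃ C : ℝ≥0∞, C ≠ ∞ ∧ ∀ ε₁ ε₂ : ℝ, (ε₁ = 1 ∨ ε₁ = -1) → (ε₂ = 1 ∨ ε₂ = -1) →
      ∀ f g : (Fin (d + 2) → ℤ) × ℝ → ℝ≥0∞, Measurable f → Measurable g →
      l2norm (freqMeasure (d + 2)) (fun z => ∫⁻ y, (modWeight b (modulation ε₁ (z - y)) * f (z - y)) *
        (freqWeight a y.1 * modWeight b (modulation ε₂ y) * g y) ∂freqMeasure (d + 2)) ≤
      C * (l2norm (freqMeasure (d + 2)) f * l2norm (freqMeasure (d + 2)) g) := by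
  obtain ⟨C, hC, hker⟩ := tsum_lintegral_kernel_le (d := d) (p := 2 * a) (r := 2 * b)
    (by linarith) (by linarith)
  have hmw := measurable_modWeight b
  have hfw := measurable_freqWeight (n := d + 2) a
  have hmod := measurable_modulation (n := d + 2)
  have same : ∀ ε : ℝ, (ε = 1 ∨ ε = -1) →
      ∀ f g : (Fin (d + 2) → ℤ) × ℝ → ℝ≥0∞, Measurable f → Measurable g →
      l2norm (freqMeasure (d + 2)) (fun z => ∫⁻ y, (modWeight b (modulation ε (z - y)) * f (z - y)) *
        (freqWeight a y.1 * modWeight b (modulation ε y) * g y) ∂freqMeasure (d + 2)) ≤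
      C ^ (1 / 2 : ℝ) * (l2norm (freqMeasure (d + 2)) f * l2norm (freqMeasure (d + 2)) g) := by
    intro ε hε f g hf hg
    have hmε := hmod ε
    refine l2norm_conv_le (w₁ := fun y => modWeight b (modulation ε y))
      (w₂ := fun y => freqWeight a y.1 * modWeight b (modulation ε y))
      (by fun_prop) (by fun_prop) hf hg fun z => ?_
    rw [lintegral_freqMeasure (by fun_prop)]
    simp_rw [mul_pow, modWeight_sq, freqWeight_sq]
    exact hker ε hε z.1 z.2
  refine ⟨C ^ (1 / 2 : ℝ), by finiteness, fun ε₁ ε₂ h₁ h₂ f g hf hg => ?_⟩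
  by_cases h : ε₂ = ε₁
  · exact h ▸ same ε₁ h₁ f g hf hg
  have h' : ε₂ = -ε₁ := by
    rcases h₁ with rfl | rfl <;> rcases h₂ with rfl | rfl <;> simp_all
  have hmε₁ := hmod ε₁
  have hmε₂ := hmod ε₂
  rw [← l2norm_conv_neg (F := fun y => modWeight b (modulation ε₁ y) * f y)
    (H := fun y => freqWeight a y.1 * modWeight b (modulation ε₂ y) * g y)
    (by fun_prop) (by fun_prop)]
  have hneg : l2norm (freqMeasure (d + 2)) (fun y => g (-y)) = l2norm (freqMeasure (d + 2)) g := by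
    rw [l2norm, l2norm, lintegral_neg_eq_self (fun y => g y ^ 2)]
  have := same ε₁ h₁ f (fun y => g (-y)) hf (by fun_prop)
  rw [hneg] at this
  refine le_trans (le_of_eq ?_) this
  simp_rw [modulation_neg, modWeight_neg, Prod.fst_neg, freqWeight_neg, h', neg_neg]

section PiMeasure

variable {X : Type*} [MeasurableSpace X] {μ : Measure X} [SigmaFinite μ] {m : ℕ}

lemma lintegral_pi_insertNth (i : Fin (m + 1)) {φ : (Fin (m + 1) → X) → ℝ≥0∞}
    (hφ : Measurable φ) :
    ∫⁻ Z, φ Z ∂Measure.pi (fun _ => μ) =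
      ∫⁻ Z, ∫⁻ z, φ (i.insertNth z Z) ∂μ ∂Measure.pi (fun _ => μ) := by
  have h := (measurePreserving_piFinSuccAbove (fun _ => μ) i).symm
  rw [← h.lintegral_comp hφ]
  exact lintegral_prod_symm _ (hφ.comp h.measurable).aemeasurable

lemma measurable_insertNth (i : Fin (m + 1)) :
    Measurable fun p : X × (Fin m → X) => (i.insertNth p.1 p.2 : Fin (m + 1) → X) :=
  (MeasurableEquiv.piFinSuccAbove (fun _ => X) i).symm.measurable

lemma lintegral_pi_prod {g : Fin m → X → ℝ≥0∞} (hg : ∀ j, Measurable (g j)) :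
    ∫⁻ Z, ∏ j, g j (Z j) ∂Measure.pi (fun _ => μ) = ∏ j, ∫⁻ z, g j z ∂μ := by
  induction m with
  | zero => simp
  | succ m ih =>
    rw [lintegral_pi_insertNth 0 (by fun_prop), Fin.prod_univ_succ, ← ih (fun j => hg j.succ),
      mul_comm, ← lintegral_mul_const _ (by fun_prop)]
    refine lintegral_congr fun Z => ?_
    simp_rw [Fin.prod_univ_succ, Fin.insertNth_zero', Fin.cons_zero, Fin.cons_succ]
    rw [lintegral_mul_const _ (hg 0), mul_comm]

lemma lintegral_pi_comp_perm (π : Equiv.Perm (Fin m)) {φ : (Fin m → X) → ℝ≥0∞}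
    (hφ : Measurable φ) :
    ∫⁻ Z, φ (fun i => Z (π i)) ∂Measure.pi (fun _ => μ) = ∫⁻ Z, φ Z ∂Measure.pi (fun _ => μ) :=
  ((measurePreserving_piCongrLeft (fun _ => μ) π).symm).lintegral_comp hφ

/-- Integrating out the coordinate omitted from a product leaves the function of the sum. -/
lemma lintegral_pi_prod_mul_sum {G : Type*} [AddCommGroup G] [MeasurableSpace G] [MeasurableAdd₂ G]
    {μ : Measure G} [SigmaFinite μ] [μ.IsAddLeftInvariant] (q : Fin (m + 1))
    {g : Fin m → G → ℝ≥0∞} (hg : ∀ j, Measurable (g j)) {φ : G → ℝ≥0∞} (hφ : Measurable φ) :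
    ∫⁻ Z, (∏ j, g j (Z (q.succAbove j))) * φ (∑ i, Z i) ∂Measure.pi (fun _ => μ) =
      (∏ j, ∫⁻ z, g j z ∂μ) * ∫⁻ z, φ z ∂μ := by
  rw [lintegral_pi_insertNth q (by fun_prop), ← lintegral_pi_prod hg,
    ← lintegral_mul_const _ (by fun_prop)]
  refine lintegral_congr fun Z => ?_
  simp_rw [Fin.sum_univ_succAbove _ q, Fin.insertNth_apply_same, Fin.insertNth_apply_succAbove]
  rw [lintegral_const_mul _ (by fun_prop), lintegral_add_right_eq_self φ]

lemma pi_count {A : Type*} [MeasurableSpace A] [Countable A] [MeasurableSingletonClass A] :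
    Measure.pi (fun _ : Fin m => (Measure.count : Measure A)) = Measure.count := by
  refine Measure.ext_of_singleton fun K => ?_
  simp

lemma lintegral_pi_count_prod {A B : Type*} [MeasurableSpace A] [Countable A]
    [MeasurableSingletonClass A] [MeasurableSpace B] {ν : Measure B} [SigmaFinite ν]
    {φ : (Fin m → A × B) → ℝ≥0∞} (hφ : Measurable φ) :
    ∫⁻ Z, φ Z ∂Measure.pi (fun _ => (Measure.count : Measure A).prod ν) =
      ∑' K : Fin m → A, ∫⁻ T, φ (fun j => (K j, T j)) ∂Measure.pi (fun _ => ν) := by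
  have h := (measurePreserving_arrowProdEquivProdArrow A B (Fin m)
    (fun _ => Measure.count) (fun _ => ν)).symm
  rw [← h.lintegral_comp hφ]
  refine (lintegral_prod _ (hφ.comp h.measurable).aemeasurable).trans ?_
  rw [pi_count, lintegral_count]
  rfl

end PiMeasure

section Forms

variable {G : Type*} [AddCommGroup G] [MeasurableSpace G] [MeasurableAdd₂ G] [MeasurableNeg G]
  {μ : Measure G} [SigmaFinite μ] [μ.IsAddLeftInvariant]

lemma lintegral_pi_fin_two_le {V : G → ℝ≥0∞} (hV : Measurable V) {F : Fin 2 → G → ℝ≥0∞}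
    (hF : ∀ i, Measurable (F i)) :
    ∫⁻ Z, V (∑ i, Z i) * ∏ i, F i (Z i) ∂Measure.pi (fun _ : Fin 2 => μ) ≤
      l2norm μ V * l2norm μ (fun z => ∫⁻ x, F 0 (z - x) * F 1 x ∂μ) := by
  have hmeas : Measurable fun z => ∫⁻ x, F 0 (z - x) * F 1 x ∂μ :=
    Measurable.lintegral_prod_right' (f := fun p : G × G => F 0 (p.1 - p.2) * F 1 p.2) (by fun_prop)
  refine le_trans (le_of_eq ?_) (lintegral_mul_le_l2norm hV hmeas)
  have h := (measurePreserving_finTwoArrow μ).symm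
  rw [← h.lintegral_comp (f := fun Z => V (∑ i, Z i) * ∏ i, F i (Z i)) (by fun_prop)]
  refine (lintegral_prod_symm _ (Measurable.aemeasurable ?_)).trans ?_
  · exact Measurable.comp (g := fun Z : Fin 2 → G => V (∑ i, Z i) * ∏ i, F i (Z i))
      (by fun_prop) h.measurable
  calc _ = ∫⁻ y, ∫⁻ x, V (x + y) * (F 0 x * F 1 y) ∂μ ∂μ := by
        refine lintegral_congr fun y => lintegral_congr fun x => ?_
        simp
    _ = ∫⁻ y, ∫⁻ z, V z * (F 0 (z - y) * F 1 y) ∂μ ∂μ := by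
        refine lintegral_congr fun y => ?_
        rw [← lintegral_sub_right_eq_self _ y]
        simp
    _ = _ := by
        rw [lintegral_lintegral_swap (by fun_prop)]
        refine lintegral_congr fun z => ?_
        rw [lintegral_const_mul _ (by fun_prop)]

lemma lintegral_pi_add_three_le [μ.IsNegInvariant] {m : ℕ} {V : G → ℝ≥0∞} (hV : Measurable V)
    {F : Fin (m + 3) → G → ℝ≥0∞} (hF : ∀ i, Measurable (F i)) :
    ∫⁻ Z, V (∑ i, Z i) * ∏ i, F i (Z i) ∂Measure.pi (fun _ => μ) ≤
      (∏ j : Fin m, ∫⁻ z, F j.succ.succ.succ z ∂μ) *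
        (l2norm μ (fun z => ∫⁻ x, V (z - x) * F 2 x ∂μ) *
          l2norm μ (fun z => ∫⁻ x, F 0 (z - x) * F 1 x ∂μ)) := by
  have hcons : ∀ (k : ℕ) (φ : (Fin (k + 1) → G) → ℝ≥0∞), Measurable φ →
      ∫⁻ Z, φ Z ∂Measure.pi (fun _ => μ) =
        ∫⁻ Z, ∫⁻ z, φ (Fin.cons z Z) ∂μ ∂Measure.pi (fun _ => μ) := fun k φ hφ => by
    rw [lintegral_pi_insertNth 0 hφ]
    simp_rw [Fin.insertNth_zero']
  have hmeas : ∀ (k : ℕ) (φ : (Fin (k + 1) → G) → ℝ≥0∞), Measurable φ →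
      Measurable fun Z => ∫⁻ z, φ (Fin.cons z Z) ∂μ := fun k φ hφ => by
    refine Measurable.lintegral_prod_left' (f := fun p : G × (Fin k → G) => φ (Fin.cons p.1 p.2)) ?_
    have := hφ.comp (measurable_insertNth (0 : Fin (k + 1)))
    simpa only [Function.comp_def, Fin.insertNth_zero'] using this
  have h₀ : Measurable fun Z : Fin (m + 3) → G => V (∑ i, Z i) * ∏ i, F i (Z i) := by fun_prop
  rw [hcons _ _ h₀, hcons _ _ (hmeas _ _ h₀), hcons _ _ (hmeas _ _ (hmeas _ _ h₀)),
    ← lintegral_pi_prod (g := fun j : Fin m => F j.succ.succ.succ) (fun j => hF _),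
    ← lintegral_mul_const _ (by fun_prop)]
  refine lintegral_mono fun Z => ?_
  calc _ = ∫⁻ z₂, ∫⁻ z₁, ∫⁻ z₀, (∏ j : Fin m, F j.succ.succ.succ (Z j)) *
          (V (z₀ + z₂ + z₁ + ∑ j, Z j) * (F 0 z₀ * F 2 z₂ * F 1 z₁)) ∂μ ∂μ ∂μ := by
        refine lintegral_congr fun z₂ => lintegral_congr fun z₁ => lintegral_congr fun z₀ => ?_
        simp only [Fin.sum_univ_succ, Fin.prod_univ_succ, Fin.cons_zero, Fin.cons_succ,
          Fin.succ_zero_eq_one, Fin.succ_one_eq_two]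
        rw [(by abel : z₀ + (z₁ + (z₂ + ∑ j, Z j)) = z₀ + z₂ + z₁ + ∑ j, Z j)]
        ring
    _ = (∏ j : Fin m, F j.succ.succ.succ (Z j)) * ∫⁻ z₂, ∫⁻ z₁, ∫⁻ z₀,
          V (z₀ + z₂ + z₁ + ∑ j, Z j) * (F 0 z₀ * F 2 z₂ * F 1 z₁) ∂μ ∂μ ∂μ := by
        have m₃ : Measurable fun p : (G × G) × G =>
          V (p.2 + p.1.1 + p.1.2 + ∑ j, Z j) * (F 0 p.2 * F 2 p.1.1 * F 1 p.1.2) := by fun_prop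
        have m₂ : Measurable fun p : G × G => ∫⁻ z₀,
            V (z₀ + p.1 + p.2 + ∑ j, Z j) * (F 0 z₀ * F 2 p.1 * F 1 p.2) ∂μ :=
          m₃.lintegral_prod_right'
        rw [← lintegral_const_mul _ m₂.lintegral_prod_right']
        refine lintegral_congr fun z₂ => ?_
        have m₁ : Measurable fun z₁ => ∫⁻ z₀,
            V (z₀ + z₂ + z₁ + ∑ j, Z j) * (F 0 z₀ * F 2 z₂ * F 1 z₁) ∂μ :=
          m₂.comp measurable_prodMk_left
        rw [← lintegral_const_mul _ m₁]
        refine lintegral_congr fun z₁ => ?_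
        rw [lintegral_const_mul _ (by fun_prop)]
    _ ≤ _ := by
        gcongr
        exact lintegral_triple_le hV (hF 0) (hF 2) (hF 1) _

end Forms

lemma freqWeight_zero {n : ℕ} (k : Fin n → ℤ) : freqWeight 0 k = 1 := by simp [freqWeight]

lemma modWeight_zero (x : ℝ) : modWeight 0 x = 1 := by simp [modWeight]

lemma modWeight_le_one {r : ℝ} (hr : 0 ≤ r) (x : ℝ) : modWeight r x ≤ 1 := by
  rw [modWeight, ENNReal.ofReal_le_one]
  exact Real.rpow_le_one_of_one_le_of_nonpos (one_le_jb x) (by linarith)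

/-- Decay exponents in the frequencies, indexed by decreasing frequency: none for the largest,
`a` for the next two, `c` for the others. -/
noncomputable def bilinearExponent (a c : ℝ) (i : ℕ) : ℝ :=
  if i = 0 then 0 else if i ≤ 2 then a else c

/-- Decay exponents in the frequencies: none for the largest, `c` for the others. -/
noncomputable def sobolevExponent (c : ℝ) (i : ℕ) : ℝ := if i = 0 then 0 else c

lemma lintegral_freqWeight_mul_modWeight_le {n : ℕ} {b c : ℝ} (hb : 1 / 2 < b)
    (hc : (n : ℝ) / 2 < c) : ∃ C : ℝ≥0∞, C ≠ ∞ ∧ ∀ (ε : ℝ) (F : (Fin n → ℤ) × ℝ → ℝ≥0∞),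
      Measurable F →
      ∫⁻ z, freqWeight c z.1 * modWeight b (modulation ε z) * F z ∂freqMeasure n ≤
        C * l2norm (freqMeasure n) F := by
  have h₁ := tsum_freqWeight_ne_top (n := n) (p := 2 * c) (by linarith)
  have h₂ := (lintegral_modWeight_lt_top (r := 2 * b) (by linarith)).ne
  refine ⟨((∑' k : Fin n → ℤ, freqWeight (2 * c) k) * ∫⁻ x, modWeight (2 * b) x) ^ (1 / 2 : ℝ),
    by finiteness, fun ε F hF => ?_⟩
  have hmw := measurable_modWeight b
  have hfw := measurable_freqWeight (n := n) c
  have hmod := measurable_modulation (n := n) ε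
  refine (lintegral_mul_le_l2norm (f := fun z => freqWeight c z.1 * modWeight b (modulation ε z))
    (by fun_prop) hF).trans (le_of_eq ?_)
  rw [l2norm, lintegral_freqMeasure (by fun_prop)]
  simp_rw [mul_pow, freqWeight_sq, modWeight_sq]
  have : ∀ k : Fin n → ℤ, ∫⁻ τ, freqWeight (2 * c) k * modWeight (2 * b) (modulation ε (k, τ)) =
      freqWeight (2 * c) k * ∫⁻ x, modWeight (2 * b) x := by
    intro k
    rw [lintegral_const_mul' _ _ (by simp [freqWeight])]
    simp only [modulation]
    rw [lintegral_modWeight_add_mul]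
  simp_rw [this]
  rw [ENNReal.tsum_mul_right]

/-- The multilinear form in which every factor carries modulation decay. -/
lemma lintegral_form_bilinear_le {d α : ℕ} (hα : 1 ≤ α) {a b c : ℝ} (ha : (d : ℝ) / 2 < a)
    (hb : 1 / 2 < b) (hc : ((d + 2 : ℕ) : ℝ) / 2 < c) :
    ∃ C : ℝ≥0∞, C ≠ ∞ ∧ ∀ ε : Fin (α + 1) → ℝ, (∀ i, ε i = 1 ∨ ε i = -1) →
      ∀ (v : (Fin (d + 2) → ℤ) × ℝ → ℝ≥0∞) (F : Fin (α + 1) → (Fin (d + 2) → ℤ) × ℝ → ℝ≥0∞),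
      Measurable v → (∀ i, Measurable (F i)) →
      ∫⁻ Z, (modWeight b (modulation 1 (∑ i, Z i)) * v (∑ i, Z i)) *
        ∏ i : Fin (α + 1), (freqWeight (bilinearExponent a c i) (Z i).1 *
          modWeight b (modulation (ε i) (Z i)) * F i (Z i))
          ∂Measure.pi (fun _ => freqMeasure (d + 2)) ≤
      C * (l2norm (freqMeasure (d + 2)) v * ∏ i, l2norm (freqMeasure (d + 2)) (F i)) := by
  obtain ⟨C, hC, hbil⟩ := l2norm_bilinear_le ha hb
  obtain ⟨K, hK, hlin⟩ := lintegral_freqWeight_mul_modWeight_le (n := d + 2) hb hc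
  have hmw := measurable_modWeight b
  have hfw := measurable_freqWeight (n := d + 2)
  have hmod := measurable_modulation (n := d + 2)
  have e0 : bilinearExponent a c 0 = 0 := by simp [bilinearExponent]
  have e1 : bilinearExponent a c 1 = a := by simp [bilinearExponent]
  have e2 : bilinearExponent a c 2 = a := by simp [bilinearExponent]
  obtain _ | _ | m := α
  · omega
  · refine ⟨C, hC, fun ε hε v F hv hF => ?_⟩
    have h := lintegral_pi_fin_two_le (μ := freqMeasure (d + 2))
      (V := fun z => modWeight b (modulation 1 z) * v z) (by have := hmod 1; fun_prop)
      (F := fun i z => freqWeight (bilinearExponent a c i) z.1 *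
          modWeight b (modulation (ε i) z) * F i z)
      (fun i => by have := hmod (ε i); have := hfw (bilinearExponent a c i); fun_prop)
    refine h.trans ?_
    have hv' : l2norm (freqMeasure (d + 2)) (fun z => modWeight b (modulation 1 z) * v z) ≤
        l2norm (freqMeasure (d + 2)) v := by
      unfold l2norm
      gcongr with z
      exact mul_le_of_le_one_left' (modWeight_le_one (by linarith) _)
    have h2 := hbil (ε 0) (ε 1) (hε 0) (hε 1) (F 0) (F 1) (hF 0) (hF 1)
    simp only [Fin.val_zero, Fin.val_one, e0, e1, freqWeight_zero, one_mul]
    calc _ ≤ l2norm (freqMeasure (d + 2)) v * (C * (l2norm (freqMeasure (d + 2)) (F 0) *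
            l2norm (freqMeasure (d + 2)) (F 1))) := mul_le_mul' hv' h2
      _ = _ := by
        rw [Fin.prod_univ_two]
        ring
  · refine ⟨K ^ m * (C * C), by finiteness, fun ε hε v F hv hF => ?_⟩
    have h := lintegral_pi_add_three_le (μ := freqMeasure (d + 2)) (m := m)
      (V := fun z => modWeight b (modulation 1 z) * v z) (by have := hmod 1; fun_prop)
      (F := fun i z => freqWeight (bilinearExponent a c i) z.1 *
          modWeight b (modulation (ε i) z) * F i z)
      (fun i => by have := hmod (ε i); have := hfw (bilinearExponent a c i); fun_prop)
    refine h.trans ?_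
    have h01 := hbil (ε 0) (ε 1) (hε 0) (hε 1) (F 0) (F 1) (hF 0) (hF 1)
    have hv2 := hbil 1 (ε 2) (Or.inl rfl) (hε 2) v (F 2) hv (hF 2)
    have hrest : ∏ j : Fin m, ∫⁻ z, freqWeight (bilinearExponent a c (j.succ.succ.succ : Fin (m + 3))) z.1 *
          modWeight b (modulation (ε j.succ.succ.succ) z) * F j.succ.succ.succ z
            ∂freqMeasure (d + 2) ≤
        K ^ m * ∏ j : Fin m, l2norm (freqMeasure (d + 2)) (F j.succ.succ.succ) := by
      have e3 : ∀ j : Fin m, bilinearExponent a c (j.succ.succ.succ : Fin (m + 3)) = c := by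
        intro j
        simp [bilinearExponent]
      simp_rw [e3]
      refine (Finset.prod_le_prod' fun j _ => hlin _ _ (hF _)).trans (le_of_eq ?_)
      rw [Finset.prod_mul_distrib]
      simp
    have v2 : ((2 : Fin (m + 3)) : ℕ) = 2 := rfl
    simp only [Fin.val_zero, Fin.val_one, v2, e0, e1, e2, freqWeight_zero, one_mul]
    calc _ ≤ _ := mul_le_mul' hrest (mul_le_mul' hv2 h01)
      _ = _ := by
        simp only [Fin.prod_univ_succ, Fin.succ_zero_eq_one, Fin.succ_one_eq_two]
        ring

/-- The multilinear form in which the factor `q` and the output carry no modulation decay. -/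
lemma lintegral_form_sobolev_le {n α : ℕ} {b c : ℝ} (hb : 1 / 2 < b) (hc : (n : ℝ) / 2 < c)
    (q : Fin (α + 1)) :
    ∃ C : ℝ≥0∞, C ≠ ∞ ∧ ∀ (ε : Fin (α + 1) → ℝ)
      (v : (Fin n → ℤ) × ℝ → ℝ≥0∞) (F : Fin (α + 1) → (Fin n → ℤ) × ℝ → ℝ≥0∞),
      Measurable v → (∀ i, Measurable (F i)) →
      ∫⁻ Z, v (∑ i, Z i) * ∏ i : Fin (α + 1), (freqWeight (sobolevExponent c i) (Z i).1 *
          modWeight (if i = q then 0 else b) (modulation (ε i) (Z i)) * F i (Z i))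
          ∂Measure.pi (fun _ => freqMeasure n) ≤
      C * (l2norm (freqMeasure n) v * ∏ i, l2norm (freqMeasure n) (F i)) := by
  have h₁ := tsum_freqWeight_ne_top (n := n) (p := 2 * c) (by linarith)
  have h₂ := (lintegral_modWeight_lt_top (r := 2 * b) (by linarith)).ne
  set S := ∑' k : Fin n → ℤ, freqWeight (2 * c) k
  set I := ∫⁻ x, modWeight (2 * b) x
  refine ⟨(S ^ α * I ^ α) ^ (1 / 2 : ℝ), by finiteness, fun ε v F hv hF => ?_⟩
  have hmw := measurable_modWeight
  have hfw := measurable_freqWeight (n := n)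
  have hmod := measurable_modulation (n := n)
  set W : (Fin (α + 1) → (Fin n → ℤ) × ℝ) → ℝ≥0∞ := fun Z => ∏ i : Fin (α + 1),
    (freqWeight (sobolevExponent c i) (Z i).1 *
      modWeight (if i = q then 0 else b) (modulation (ε i) (Z i))) with hW
  have hWm : Measurable W := by
    refine Finset.measurable_prod _ fun i _ => ?_
    have := hmw (if i = q then 0 else b)
    have := hmod (ε i)
    have := hfw (sobolevExponent c i)
    fun_prop
  have hfst : l2norm (Measure.pi fun _ => freqMeasure n) (fun Z => v (∑ i, Z i) * W Z) =
      (S ^ α * I ^ α) ^ (1 / 2 : ℝ) * l2norm (freqMeasure n) v := by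
    unfold l2norm
    rw [← ENNReal.mul_rpow_of_nonneg _ _ (by norm_num)]
    congr 1
    rw [lintegral_pi_count_prod (by fun_prop), lintegral_freqMeasure (by fun_prop)]
    have inner : ∀ K : Fin (α + 1) → Fin n → ℤ,
        ∫⁻ T, (v (∑ i, (K i, T i)) * W fun i => (K i, T i)) ^ 2 ∂Measure.pi (fun _ => volume) =
          (∏ j : Fin α, freqWeight (2 * c) (K (Fin.succAbove 0 j))) *
            (I ^ α * ∫⁻ t, v (∑ i, K i, t) ^ 2) := by
      intro K
      have hsum : ∀ T : Fin (α + 1) → ℝ, ∑ i, (K i, T i) = (∑ i, K i, ∑ i, T i) := fun T =>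
        Prod.ext (by simp [Prod.fst_sum]) (by simp [Prod.snd_sum])
      have hWsq : ∀ T : Fin (α + 1) → ℝ, W (fun i => (K i, T i)) ^ 2 =
          (∏ j : Fin α, freqWeight (2 * c) (K (Fin.succAbove 0 j))) *
          ∏ j : Fin α, modWeight (2 * b) (T (q.succAbove j) +
            ε (q.succAbove j) * zn2 (K (q.succAbove j))) := by
        intro T
        simp only [hW, Finset.prod_mul_distrib, mul_pow]
        congr 1
        · rw [Fin.prod_univ_succAbove _ 0, mul_pow, ← Finset.prod_pow]
          simp [sobolevExponent, freqWeight_zero, freqWeight_sq]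
        · rw [Fin.prod_univ_succAbove _ q, mul_pow, ← Finset.prod_pow]
          simp [modWeight_zero, modWeight_sq, modulation]
      have hm2 := hmw (2 * b)
      have hprod := lintegral_pi_prod_mul_sum (μ := (volume : Measure ℝ)) q
        (g := fun j t => modWeight (2 * b) (t + ε (q.succAbove j) * zn2 (K (q.succAbove j))))
        (fun j => by fun_prop) (φ := fun t => v (∑ i, K i, t) ^ 2) (by fun_prop)
      simp_rw [lintegral_modWeight_add_mul, Finset.prod_const, Finset.card_univ,
        Fintype.card_fin] at hprod
      rw [← hprod, ← lintegral_const_mul _ (by fun_prop)]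
      refine lintegral_congr fun T => ?_
      rw [mul_pow, hWsq, hsum]
      ring
    simp_rw [inner]
    have hprod := lintegral_pi_prod_mul_sum (μ := (Measure.count : Measure (Fin n → ℤ)))
      (0 : Fin (α + 1)) (g := fun _ => freqWeight (2 * c)) (fun _ => hfw _)
      (φ := fun k => I ^ α * ∫⁻ t, v (k, t) ^ 2) Measurable.of_discrete
    rw [pi_count, lintegral_count, lintegral_count, lintegral_count] at hprod
    rw [hprod, Finset.prod_const, Finset.card_univ, Fintype.card_fin, ENNReal.tsum_mul_left,
      mul_assoc]
  have hsnd : l2norm (Measure.pi fun _ => freqMeasure n) (fun Z => ∏ i, F i (Z i)) =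
      ∏ i, l2norm (freqMeasure n) (F i) := by
    unfold l2norm
    simp_rw [← Finset.prod_pow]
    rw [lintegral_pi_prod (g := fun i z => F i z ^ 2) (fun i => by fun_prop),
      ENNReal.prod_rpow_of_nonneg (by norm_num)]
  calc _ = ∫⁻ Z, (v (∑ i, Z i) * W Z) * ∏ i, F i (Z i) ∂Measure.pi (fun _ => freqMeasure n) := by
        refine lintegral_congr fun Z => ?_
        rw [Finset.prod_mul_distrib, mul_assoc]
    _ ≤ _ := lintegral_mul_le_l2norm (by fun_prop) (by fun_prop)
    _ = _ := by rw [hfst, hsnd, mul_assoc]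

lemma modWeight_eq_exp (r x : ℝ) : modWeight r x = ENNReal.ofReal (Real.exp (-(r * Real.log (jb x)))) := by
  rw [modWeight, Real.rpow_def_of_pos (jb_pos x)]
  congr 2
  ring

lemma freqWeight_eq_exp {n : ℕ} (r : ℝ) (k : Fin n → ℤ) :
    freqWeight r k = ENNReal.ofReal (Real.exp (-(r * Real.log (jbk k)))) := by
  rw [freqWeight, Real.rpow_def_of_pos (jbk_pos k)]
  congr 2
  ring

lemma jbk_sum_le {n m : ℕ} (K : Fin (m + 1) → Fin n → ℤ) {M : ℝ} (hM : ∀ i, jbk (K i) ≤ M) :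
    jbk (∑ i, K i) ≤ ((m : ℝ) + 1) * M := by
  have hM0 : 0 < M := (jbk_pos _).trans_le (hM 0)
  have hz : ∀ i, zn2 (K i) ≤ M ^ 2 - 1 := fun i => by
    have := (Real.sqrt_le_left hM0.le).1 (hM i)
    linarith
  have hsum : zn2 (∑ i, K i) ≤ ((m : ℝ) + 1) ^ 2 * (M ^ 2 - 1) := by
    calc zn2 (∑ i, K i) = ∑ j, (∑ i, (K i j : ℝ)) ^ 2 := by simp [zn2, Finset.sum_apply]
      _ ≤ ∑ j, ((m : ℝ) + 1) * ∑ i, (K i j : ℝ) ^ 2 := by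
        refine Finset.sum_le_sum fun j _ => ?_
        have := sq_sum_le_card_mul_sum_sq (s := Finset.univ) (f := fun i => (K i j : ℝ))
        simpa using this
      _ = ((m : ℝ) + 1) * ∑ i, zn2 (K i) := by
        rw [← Finset.mul_sum, Finset.sum_comm]
        rfl
      _ ≤ ((m : ℝ) + 1) * ∑ _i : Fin (m + 1), (M ^ 2 - 1) := by
        gcongr with i
        exact hz i
      _ = _ := by
        simp
        ring
  rw [jbk, Real.sqrt_le_left (by positivity)]
  nlinarith [sq_nonneg (m : ℝ), (Nat.cast_nonneg m : (0 : ℝ) ≤ m)]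

/-- A Chebyshev-type rearrangement inequality for weights that are below average on the two
largest entries and above average on the others. -/
lemma sum_mul_le_of_antitone {α : ℕ} {e y : Fin α → ℝ} {s : ℝ} (hy : Antitone y)
    (hsum : ∑ i, e i = α * s) (h₁ : ∀ i : Fin α, (i : ℕ) ≤ 1 → e i ≤ s)
    (h₂ : ∀ i : Fin α, 2 ≤ (i : ℕ) → s ≤ e i) : ∑ i, e i * y i ≤ s * ∑ i, y i := by
  obtain ⟨Y, hY⟩ : ∃ Y, ∀ i : Fin α, ((i : ℕ) ≤ 1 → Y ≤ y i) ∧ (2 ≤ (i : ℕ) → y i ≤ Y) := by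
    obtain _ | _ | m := α
    · exact ⟨0, fun i => i.elim0⟩
    · exact ⟨y 0, fun i => by
        obtain rfl : i = 0 := Fin.ext (by omega)
        simp⟩
    · exact ⟨y 1, fun i => ⟨fun h => hy (Fin.le_def.2 (by simpa using h)),
        fun h => hy (Fin.le_def.2 (by simp; omega))⟩⟩
  have hnn : 0 ≤ ∑ i, (s - e i) * (y i - Y) := Finset.sum_nonneg fun i _ => by
    rcases Nat.lt_or_ge (i : ℕ) 2 with h | h
    · exact mul_nonneg (by linarith [h₁ i (by omega)]) (by linarith [(hY i).1 (by omega)])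
    · exact mul_nonneg_of_nonpos_of_nonpos (by linarith [h₂ i h]) (by linarith [(hY i).2 h])
  have hexp : ∑ i, (s - e i) * (y i - Y) =
      s * ∑ i, y i - ∑ i, e i * y i - (α * s - ∑ i, e i) * Y := by
    simp only [sub_mul, mul_sub, Finset.sum_sub_distrib, ← Finset.mul_sum, ← Finset.sum_mul]
    simp
    ring
  rw [hexp, hsum] at hnn
  linarith

/-- The exponents for which the two families of forms interpolate to the desired weight. -/
structure InterpolationExponents (n α : ℕ) (s a b b' c θ : ℝ) : Prop where
  a_gt : (n : ℝ) / 2 - 1 < a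
  b'_gt : 1 / 2 < b'
  c_gt : (n : ℝ) / 2 < c
  b_pos : 0 < b
  b_lt : b < 1 / 2
  θ_pos : 0 < θ
  θ_lt : θ < 1
  b_eq : b = b' * (θ + (1 - θ) * (α / (α + 1)))
  sum_eq : ∑ i : Fin α, (θ * bilinearExponent a c (i + 1) + (1 - θ) * sobolevExponent c (i + 1)) =
    α * s
  le_s : θ * a + (1 - θ) * c ≤ s
  s_le : 3 ≤ α → s ≤ c

lemma exists_interpolationExponents {n α : ℕ} (hn : 2 ≤ n) (hα : 1 ≤ α) {s : ℝ}
    (hs : salphan α n < s) : ∃ a b b' c θ, InterpolationExponents n α s a b b' c θ := by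
  have hn' : (2 : ℝ) ≤ n := by exact_mod_cast hn
  obtain ⟨δ, hδ, hsδ⟩ : ∃ δ : ℝ, 0 < δ ∧
      ((α = 1 ∧ s = n / 2 - 1 + δ) ∨ (2 ≤ α ∧ s = n / 2 - 2 / α + δ)) := by
    unfold salphan at hs
    split_ifs at hs with h1 h2
    · exact ⟨s - (n / 2 - 1), by linarith, Or.inl ⟨h1, by ring⟩⟩
    · refine ⟨s - (n / 2 - 1), ?_, Or.inr ⟨by omega, by rw [h2]; push_cast; ring⟩⟩
      have : 1 / (4 * ((n : ℝ) - 1)) ≤ 1 / 4 :=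
        one_div_le_one_div_of_le (by norm_num) (by linarith)
      linarith
    · exact ⟨s - (n / 2 - 2 / α), by linarith, Or.inr ⟨by omega, by ring⟩⟩
  set θ := 1 / (1 + δ / 2) with hθ
  have hθ0 : 0 < θ := by positivity
  have hθ1 : θ < 1 := by rw [hθ, div_lt_one (by positivity)]; linarith
  have hθδ : θ * (1 + δ / 2) = 1 := by rw [hθ]; field_simp
  have hα' : (1 : ℝ) ≤ α := by exact_mod_cast hα
  set κ : ℝ := α / (α + 1) with hκ
  have hκ0 : 0 < κ := by positivity
  have hκ1 : κ < 1 := by rw [hκ, div_lt_one (by positivity)]; linarith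
  set ρ := θ + (1 - θ) * κ with hρ
  have hρ0 : 0 < ρ := by nlinarith
  have hρ1 : ρ < 1 := by nlinarith
  have hg : θ * (n / 2 - 1 + δ / 2) + (1 - θ) * (n / 2 + δ) = n / 2 - 1 + δ := by
    linear_combination (-1 : ℝ) * hθδ
  refine ⟨n / 2 - 1 + δ / 2, (1 + 1 / ρ) / 4 * ρ, (1 + 1 / ρ) / 4, n / 2 + δ, θ,
    by linarith, ?_, by linarith, by positivity, ?_, hθ0, hθ1, rfl, ?_, ?_, ?_⟩
  · have : 1 < 1 / ρ := by rw [lt_div_iff₀ hρ0]; linarith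
    linarith
  · have : (1 + 1 / ρ) / 4 * ρ = (ρ + 1) / 4 := by field_simp
    linarith
  · rcases hsδ with ⟨rfl, h⟩ | ⟨h2, h⟩
    · simp [bilinearExponent, sobolevExponent]
      linarith
    · obtain ⟨m, rfl⟩ : ∃ m, α = m + 2 := ⟨α - 2, by omega⟩
      simp only [Fin.sum_univ_succ, Fin.val_succ, Fin.val_zero, bilinearExponent, sobolevExponent]
      simp
      rw [hg, h]
      push_cast
      field_simp
      ring
  · rw [hg]
    rcases hsδ with ⟨_, h⟩ | ⟨h2, h⟩
    · linarith
    · have : (2 : ℝ) ≤ α := by exact_mod_cast h2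
      have : 2 / (α : ℝ) ≤ 1 := by rw [div_le_one (by linarith)]; exact this
      linarith
  · intro h3
    rcases hsδ with ⟨rfl, _⟩ | ⟨_, h⟩
    · omega
    · have : 0 < 2 / (α : ℝ) := by positivity
      linarith

lemma exponent_le_of_interpolationExponents {n α : ℕ} {s a b b' c θ : ℝ}
    (h : InterpolationExponents n α s a b b' c θ) {x y : Fin (α + 1) → ℝ} {x₀ : ℝ}
    (hx₀ : 0 ≤ x₀) (hy : Antitone y) :
    b' * x₀ + ∑ i : Fin (α + 1), (bilinearExponent a c i * y i + b' * x i) ≤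
        b * x₀ - s * y 0 + ∑ i, (s * y i + b * x i) ∨
      ∃ q, ∑ i : Fin (α + 1), (sobolevExponent c i * y i + (if i = q then 0 else b') * x i) ≤
        b * x₀ - s * y 0 + ∑ i, (s * y i + b * x i) := by
  by_contra! hcon
  obtain ⟨hA, hB⟩ := hcon
  have hθ := h.θ_pos
  have hθ1 := h.θ_lt
  have hb' := h.b'_gt
  generalize hE₀ : b * x₀ - s * y 0 + ∑ i, (s * y i + b * x i) = E₀ at hA hB
  set X := ∑ i, x i with hX
  set κ : ℝ := α / (α + 1) with hκ
  have hκ0 : 0 ≤ κ := by positivity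
  have hκ1 : ((α : ℝ) + 1) * κ = α := by rw [hκ]; field_simp
  have hBsum : ((α : ℝ) + 1) * E₀ <
      ((α : ℝ) + 1) * (∑ i, sobolevExponent c (i : Fin (α + 1)) * y i) + α * (b' * X) := by
    calc ((α : ℝ) + 1) * E₀ = ∑ _q : Fin (α + 1), E₀ := by simp
      _ < ∑ q : Fin (α + 1), ∑ i : Fin (α + 1),
          (sobolevExponent c i * y i + (if i = q then 0 else b') * x i) :=
        Finset.sum_lt_sum_of_nonempty Finset.univ_nonempty fun q _ => hB q
      _ = _ := by
        rw [Finset.sum_comm]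
        have : ∀ i : Fin (α + 1), ∑ q, (sobolevExponent c i * y i + (if i = q then 0 else b') * x i) =
            ((α : ℝ) + 1) * (sobolevExponent c i * y i) + α * (b' * x i) := by
          intro i
          have hs : ∑ q, (if i = q then 0 else b') = α * b' := by
            rw [Fin.sum_univ_succAbove _ i]
            simp
          rw [Finset.sum_add_distrib, ← Finset.sum_mul (f := fun q => if i = q then 0 else b'), hs]
          simp
          ring
        simp_rw [this]
        rw [Finset.sum_add_distrib, ← Finset.mul_sum, ← Finset.mul_sum, ← Finset.mul_sum]
  have hB' : E₀ < (∑ i, sobolevExponent c (i : Fin (α + 1)) * y i) + κ * (b' * X) := by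
    have : (0 : ℝ) < (α : ℝ) + 1 := by positivity
    refine lt_of_mul_lt_mul_left ?_ this.le
    rwa [mul_add, ← mul_assoc _ κ, hκ1]
  have hcheb := sum_mul_le_of_antitone (α := α) (y := fun i => y i.succ) (s := s)
    (e := fun i => θ * bilinearExponent a c (i + 1) + (1 - θ) * sobolevExponent c (i + 1))
    (fun i j hij => hy (Fin.succ_le_succ_iff.2 hij)) h.sum_eq
    (fun i hi => by
      have : (i : ℕ) + 1 ≤ 2 := by omega
      simpa [bilinearExponent, sobolevExponent, this] using h.le_s)
    (fun i hi => by
      have h3 : ¬ (i : ℕ) + 1 ≤ 2 := by omega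
      have hsc := h.s_le (by omega)
      simp only [bilinearExponent, sobolevExponent, h3, Nat.add_eq_zero_iff, one_ne_zero,
        and_false, if_false]
      linarith)
  have eA : ∑ i : Fin (α + 1), (bilinearExponent a c i * y i + b' * x i) =
      ∑ i : Fin α, bilinearExponent a c (i + 1) * y i.succ + b' * X := by
    rw [Finset.sum_add_distrib, ← Finset.mul_sum, Fin.sum_univ_succ]
    simp [bilinearExponent, hX]
  have eB : ∑ i : Fin (α + 1), sobolevExponent c i * y i =
      ∑ i : Fin α, sobolevExponent c (i + 1) * y i.succ := by
    rw [Fin.sum_univ_succ]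
    simp [sobolevExponent]
  have e0 : E₀ = b * x₀ + s * ∑ i : Fin α, y i.succ + b * X := by
    rw [← hE₀, Finset.sum_add_distrib, ← Finset.mul_sum, ← Finset.mul_sum, Fin.sum_univ_succ y]
    ring
  have ec : ∑ i : Fin α, (θ * bilinearExponent a c (i + 1) + (1 - θ) * sobolevExponent c (i + 1)) *
        y i.succ = θ * ∑ i : Fin α, bilinearExponent a c (i + 1) * y i.succ +
      (1 - θ) * ∑ i : Fin α, sobolevExponent c (i + 1) * y i.succ := by
    rw [Finset.mul_sum, Finset.mul_sum, ← Finset.sum_add_distrib]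
    exact Finset.sum_congr rfl fun i _ => by ring
  rw [ec] at hcheb
  rw [eA] at hA
  rw [eB] at hB'
  have hbb : θ * b' ≤ b := by
    rw [h.b_eq]
    nlinarith [mul_nonneg (mul_nonneg (by linarith : 0 ≤ b') (by linarith : 0 ≤ 1 - θ)) hκ0]
  have hbX : b * X = θ * (b' * X) + (1 - θ) * (κ * (b' * X)) := by
    rw [h.b_eq]
    ring
  nlinarith [mul_lt_mul_of_pos_left hA hθ, mul_lt_mul_of_pos_left hB' (by linarith : 0 < 1 - θ),
    mul_le_mul_of_nonneg_right hbb hx₀]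

/-- The weight of the multilinear estimate is dominated by the weights of the two families of
forms, over all orderings of the frequencies. -/
lemma weight_le_sum_weights {n α : ℕ} {s a b b' c θ : ℝ} (hs : 0 ≤ s)
    (h : InterpolationExponents n α s a b b' c θ) (ε : Fin (α + 1) → ℝ)
    (Z : Fin (α + 1) → (Fin n → ℤ) × ℝ) :
    ENNReal.ofReal (jbk (∑ i, Z i).1 ^ s) * modWeight b (modulation 1 (∑ i, Z i)) *
        ∏ i, (freqWeight s (Z i).1 * modWeight b (modulation (ε i) (Z i))) ≤
      ENNReal.ofReal (((α : ℝ) + 1) ^ s) * ∑ π : Equiv.Perm (Fin (α + 1)),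
        (modWeight b' (modulation 1 (∑ i, Z i)) *
          ∏ i : Fin (α + 1), (freqWeight (bilinearExponent a c i) (Z (π i)).1 *
            modWeight b' (modulation (ε (π i)) (Z (π i)))) +
        ∑ q : Fin (α + 1), ∏ i : Fin (α + 1), (freqWeight (sobolevExponent c i) (Z (π i)).1 *
            modWeight (if i = q then 0 else b') (modulation (ε (π i)) (Z (π i))))) := by
  set π := Tuple.sort fun i => -jbk (Z i).1
  have hmono : Antitone fun i => jbk (Z (π i)).1 := fun i j hij => by
    have := Tuple.monotone_sort (fun i => -jbk (Z i).1) hij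
    simpa using this
  set y : Fin (α + 1) → ℝ := fun i => Real.log (jbk (Z (π i)).1) with hy
  set x : Fin (α + 1) → ℝ := fun i => Real.log (jb (modulation (ε (π i)) (Z (π i)))) with hx
  set x₀ := Real.log (jb (modulation 1 (∑ i, Z i))) with hx₀
  have hyanti : Antitone y := fun i j hij => Real.log_le_log (jbk_pos _) (hmono hij)
  have hprod : ∀ r t : Fin (α + 1) → ℝ, ∏ i, (freqWeight (r i) (Z (π i)).1 *
      modWeight (t i) (modulation (ε (π i)) (Z (π i)))) =
      ENNReal.ofReal (Real.exp (-∑ i, (r i * y i + t i * x i))) := by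
    intro r t
    rw [← Finset.sum_neg_distrib, Real.exp_sum, ENNReal.ofReal_prod_of_nonneg fun i _ =>
      (Real.exp_pos _).le]
    refine Finset.prod_congr rfl fun i _ => ?_
    rw [freqWeight_eq_exp, modWeight_eq_exp, ← ENNReal.ofReal_mul (Real.exp_pos _).le,
      ← Real.exp_add, neg_add]
  have hout : ENNReal.ofReal (jbk (∑ i, Z i).1 ^ s) ≤
      ENNReal.ofReal (((α : ℝ) + 1) ^ s) * ENNReal.ofReal (Real.exp (s * y 0)) := by
    rw [← ENNReal.ofReal_mul (by positivity)]
    refine ENNReal.ofReal_le_ofReal ?_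
    have hle : jbk (∑ i, Z i).1 ≤ ((α : ℝ) + 1) * jbk (Z (π 0)).1 := by
      rw [Prod.fst_sum]
      refine jbk_sum_le _ fun i => ?_
      have := hmono (Fin.zero_le (π.symm i))
      simpa using this
    have hp := jbk_pos (Z (π 0)).1
    refine (Real.rpow_le_rpow (jbk_pos _).le hle hs).trans (le_of_eq ?_)
    rw [Real.mul_rpow (by positivity) hp.le, Real.rpow_def_of_pos hp, mul_comm s]
  rw [← Equiv.prod_comp π fun i => freqWeight s (Z i).1 * modWeight b (modulation (ε i) (Z i)),
    hprod (fun _ => s) (fun _ => b), modWeight_eq_exp b]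
  calc _ ≤ (ENNReal.ofReal (((α : ℝ) + 1) ^ s) * ENNReal.ofReal (Real.exp (s * y 0))) *
          ENNReal.ofReal (Real.exp (-(b * x₀))) *
          ENNReal.ofReal (Real.exp (-∑ i, (s * y i + b * x i))) := by gcongr
    _ = ENNReal.ofReal (((α : ℝ) + 1) ^ s) *
          ENNReal.ofReal (Real.exp (-(b * x₀ - s * y 0 + ∑ i, (s * y i + b * x i)))) := by
        rw [mul_assoc, mul_assoc, ← ENNReal.ofReal_mul (Real.exp_pos _).le, ← Real.exp_add,
          ← ENNReal.ofReal_mul (Real.exp_pos _).le, ← Real.exp_add]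
        congr 3
        ring
    _ ≤ _ := by
        gcongr
        refine le_trans ?_ (Finset.single_le_sum (fun _ _ => zero_le) (Finset.mem_univ π))
        rcases exponent_le_of_interpolationExponents h (x := x) (x₀ := x₀)
          (Real.log_nonneg (one_le_jb _)) hyanti with hA | ⟨q, hB⟩
        · refine le_trans ?_ le_self_add
          rw [hprod (fun i => bilinearExponent a c i) (fun _ => b'), modWeight_eq_exp,
            ← ENNReal.ofReal_mul (Real.exp_pos _).le, ← Real.exp_add]
          refine ENNReal.ofReal_le_ofReal (Real.exp_le_exp.2 ?_)
          linarith
        · refine le_trans ?_ le_add_self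
          refine le_trans ?_ (Finset.single_le_sum (fun _ _ => zero_le) (Finset.mem_univ q))
          rw [hprod (fun i => sobolevExponent c i) (fun i => if i = q then 0 else b')]
          exact ENNReal.ofReal_le_ofReal (Real.exp_le_exp.2 (neg_le_neg hB))

lemma measurable_jbk_rpow {n : ℕ} (r : ℝ) :
    Measurable fun z : (Fin n → ℤ) × ℝ => ENNReal.ofReal (jbk z.1 ^ r) :=
  (Measurable.of_discrete (f := fun k : Fin n → ℤ => ENNReal.ofReal (jbk k ^ r))).comp
    measurable_fst

lemma lintegral_pi_sum_perm {X Q : Type*} [Fintype Q] [MeasurableSpace X] {m : ℕ} {μ : Measure X}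
    [SigmaFinite μ] (c : ℝ≥0∞) {A : Equiv.Perm (Fin m) → (Fin m → X) → ℝ≥0∞}
    {B : Q → Equiv.Perm (Fin m) → (Fin m → X) → ℝ≥0∞} (hA : ∀ π, Measurable (A π))
    (hB : ∀ q π, Measurable (B q π)) :
    ∫⁻ Z, c * ∑ π, (A π (fun i => Z (π i)) + ∑ q, B q π (fun i => Z (π i)))
        ∂Measure.pi (fun _ => μ) =
      c * ∑ π, (∫⁻ Z, A π Z ∂Measure.pi (fun _ => μ) +
        ∑ q, ∫⁻ Z, B q π Z ∂Measure.pi (fun _ => μ)) := by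
  have hcomp : ∀ π : Equiv.Perm (Fin m), Measurable fun Z : Fin m → X => fun i => Z (π i) :=
    fun π => by fun_prop
  have hAc : ∀ π, Measurable fun Z : Fin m → X => A π (fun i => Z (π i)) := fun π => (hA π).comp (hcomp π)
  have hBc : ∀ q π, Measurable fun Z : Fin m → X => B q π (fun i => Z (π i)) := fun q π =>
    (hB q π).comp (hcomp π)
  rw [lintegral_const_mul _ (by fun_prop), lintegral_finsetSum _ (by fun_prop)]
  congr 1
  refine Finset.sum_congr rfl fun π _ => ?_
  rw [lintegral_add_left (hAc π), lintegral_finsetSum _ fun q _ => hBc q π,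
    lintegral_pi_comp_perm π (hA π)]
  congr 1
  exact Finset.sum_congr rfl fun q _ => lintegral_pi_comp_perm π (hB q π)

/-- The dual form of the multilinear estimate. -/
lemma lintegral_form_le {n α : ℕ} (hn : 2 ≤ n) (hα : 1 ≤ α) {s a b b' c θ : ℝ} (hs : 0 ≤ s)
    (h : InterpolationExponents n α s a b b' c θ) :
    ∃ C : ℝ≥0∞, C ≠ ∞ ∧ ∀ ε : Fin (α + 1) → ℝ, (∀ i, ε i = 1 ∨ ε i = -1) →
      ∀ (v : (Fin n → ℤ) × ℝ → ℝ≥0∞) (F : Fin (α + 1) → (Fin n → ℤ) × ℝ → ℝ≥0∞),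
      Measurable v → (∀ i, Measurable (F i)) →
      ∫⁻ Z, v (∑ i, Z i) *
        (ENNReal.ofReal (jbk (∑ i, Z i).1 ^ s) * modWeight b (modulation 1 (∑ i, Z i)) *
          ∏ i, (freqWeight s (Z i).1 * modWeight b (modulation (ε i) (Z i)) * F i (Z i)))
          ∂Measure.pi (fun _ => freqMeasure n) ≤
      C * (l2norm (freqMeasure n) v * ∏ i, l2norm (freqMeasure n) (F i)) := by
  obtain ⟨d, rfl⟩ : ∃ d, n = d + 2 := ⟨n - 2, by omega⟩
  have ha : (d : ℝ) / 2 < a := by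
    have := h.a_gt
    push_cast at this
    linarith
  obtain ⟨C₁, hC₁, h₁⟩ := lintegral_form_bilinear_le hα ha h.b'_gt h.c_gt
  choose C₂ hC₂ h₂ using lintegral_form_sobolev_le (n := d + 2) (α := α) h.b'_gt h.c_gt
  refine ⟨ENNReal.ofReal (((α : ℝ) + 1) ^ s) *
    ∑ _π : Equiv.Perm (Fin (α + 1)), (C₁ + ∑ q, C₂ q), ?_, fun ε hε v F hv hF => ?_⟩
  · refine ENNReal.mul_ne_top ENNReal.ofReal_ne_top (ENNReal.sum_ne_top.2 fun _ _ => ?_)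
    exact ENNReal.add_ne_top.2 ⟨hC₁, ENNReal.sum_ne_top.2 fun q _ => hC₂ q⟩
  have hmw := measurable_modWeight
  have hfw := measurable_freqWeight (n := d + 2)
  have hmod := measurable_modulation (n := d + 2)
  set P : (Fin (α + 1) → ℝ) → (Fin (α + 1) → ℝ) → Equiv.Perm (Fin (α + 1)) →
    (Fin (α + 1) → (Fin (d + 2) → ℤ) × ℝ) → ℝ≥0∞ := fun r t π Z =>
    ∏ i, (freqWeight (r i) (Z i).1 * modWeight (t i) (modulation (ε (π i)) (Z i)) *
      F (π i) (Z i)) with hP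
  have hPm : ∀ r t π, Measurable (P r t π) := by
    intro r t π
    refine Finset.measurable_prod _ fun i _ => ?_
    have := hmw (t i)
    have := hmod (ε (π i))
    have := hfw (r i)
    fun_prop
  set A : Equiv.Perm (Fin (α + 1)) → (Fin (α + 1) → (Fin (d + 2) → ℤ) × ℝ) → ℝ≥0∞ := fun π Z =>
    modWeight b' (modulation 1 (∑ i, Z i)) * v (∑ i, Z i) *
      P (fun i => bilinearExponent a c i) (fun _ => b') π Z with hA
  set B : Fin (α + 1) → Equiv.Perm (Fin (α + 1)) → (Fin (α + 1) → (Fin (d + 2) → ℤ) × ℝ) → ℝ≥0∞ :=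
    fun q π Z => v (∑ i, Z i) *
      P (fun i => sobolevExponent c i) (fun i => if i = q then 0 else b') π Z with hB
  have hAm : ∀ π, Measurable (A π) := fun π => by
    have := hmod 1
    have := hmw b'
    have := hPm (fun i => bilinearExponent a c i) (fun _ => b') π
    fun_prop
  have hBm : ∀ q π, Measurable (B q π) := fun q π => by
    have := hPm (fun i => sobolevExponent c i) (fun i => if i = q then 0 else b') π
    fun_prop
  have hsplit : ∀ (r t : Fin (α + 1) → ℝ) (π : Equiv.Perm (Fin (α + 1)))
      (Z : Fin (α + 1) → (Fin (d + 2) → ℤ) × ℝ), P r t π (fun i => Z (π i)) =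
      (∏ i, (freqWeight (r i) (Z (π i)).1 * modWeight (t i) (modulation (ε (π i)) (Z (π i))))) *
        ∏ i, F i (Z i) := by
    intro r t π Z
    simp only [hP]
    rw [Finset.prod_mul_distrib, Equiv.prod_comp π fun i => F i (Z i)]
  calc _ ≤ ∫⁻ Z, ENNReal.ofReal (((α : ℝ) + 1) ^ s) * ∑ π : Equiv.Perm (Fin (α + 1)),
          (A π (fun i => Z (π i)) + ∑ q, B q π (fun i => Z (π i)))
          ∂Measure.pi (fun _ => freqMeasure (d + 2)) := by
        refine lintegral_mono fun Z => ?_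
        have hw := weight_le_sum_weights hs h ε Z
        calc _ = (ENNReal.ofReal (jbk (∑ i, Z i).1 ^ s) * modWeight b (modulation 1 (∑ i, Z i)) *
                ∏ i, (freqWeight s (Z i).1 * modWeight b (modulation (ε i) (Z i)))) *
                (v (∑ i, Z i) * ∏ i, F i (Z i)) := by
              rw [Finset.prod_mul_distrib]
              ring
          _ ≤ _ := mul_le_mul_left hw _
          _ = _ := by
              rw [mul_assoc, Finset.sum_mul]
              congr 1
              refine Finset.sum_congr rfl fun π _ => ?_
              simp only [hA, hB, hsplit, Equiv.sum_comp π Z]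
              rw [add_mul, Finset.sum_mul]
              congr 1
              · ring
              · exact Finset.sum_congr rfl fun q _ => by ring
    _ = ENNReal.ofReal (((α : ℝ) + 1) ^ s) * ∑ π : Equiv.Perm (Fin (α + 1)),
          (∫⁻ Z, A π Z ∂Measure.pi (fun _ => freqMeasure (d + 2)) +
            ∑ q, ∫⁻ Z, B q π Z ∂Measure.pi (fun _ => freqMeasure (d + 2))) :=
        lintegral_pi_sum_perm _ hAm hBm
    _ ≤ ENNReal.ofReal (((α : ℝ) + 1) ^ s) * ∑ π : Equiv.Perm (Fin (α + 1)),
          (C₁ * (l2norm (freqMeasure (d + 2)) v * ∏ i, l2norm (freqMeasure (d + 2)) (F i)) +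
            ∑ q, C₂ q * (l2norm (freqMeasure (d + 2)) v *
              ∏ i, l2norm (freqMeasure (d + 2)) (F i))) := by
        gcongr with π _ q _
        · refine (h₁ (fun i => ε (π i)) (fun i => hε _) v (fun i => F (π i)) hv
            (fun i => hF _)).trans (le_of_eq ?_)
          rw [Equiv.prod_comp π fun i => l2norm (freqMeasure (d + 2)) (F i)]
        · refine (h₂ q (fun i => ε (π i)) v (fun i => F (π i)) hv
            (fun i => hF _)).trans (le_of_eq ?_)
          rw [Equiv.prod_comp π fun i => l2norm (freqMeasure (d + 2)) (F i)]
    _ = _ := by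
        rw [mul_assoc, Finset.sum_mul]
        simp only [add_mul, Finset.sum_mul]

lemma measurable_multilinear_conv {G : Type*} [AddCommGroup G] [MeasurableSpace G]
    [MeasurableAdd₂ G] [MeasurableSub₂ G] {μ : Measure G} [SigmaFinite μ] {m : ℕ}
    {g : Fin (m + 1) → G → ℝ≥0∞} (hg : ∀ i, Measurable (g i)) :
    Measurable fun z => ∫⁻ Z, (∏ i : Fin m, g i.castSucc (Z i)) * g (Fin.last m) (z - ∑ i, Z i)
      ∂Measure.pi (fun _ => μ) := by
  refine Measurable.lintegral_prod_right' (f := fun p : G × (Fin m → G) =>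
    (∏ i : Fin m, g i.castSucc (p.2 i)) * g (Fin.last m) (p.1 - ∑ i, p.2 i)) ?_
  fun_prop

/-- Pairing a multilinear convolution with a test function gives the multilinear form. -/
lemma lintegral_mul_multilinear_conv {G : Type*} [AddCommGroup G] [MeasurableSpace G]
    [MeasurableAdd₂ G] [MeasurableSub₂ G] {μ : Measure G} [SigmaFinite μ]
    [μ.IsAddRightInvariant] {m : ℕ}
    {v : G → ℝ≥0∞} (hv : Measurable v) {g : Fin (m + 1) → G → ℝ≥0∞} (hg : ∀ i, Measurable (g i)) :
    ∫⁻ z, v z * (∫⁻ Z, (∏ i : Fin m, g i.castSucc (Z i)) * g (Fin.last m) (z - ∑ i, Z i)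
        ∂Measure.pi (fun _ => μ)) ∂μ =
      ∫⁻ Z, v (∑ i, Z i) * ∏ i, g i (Z i) ∂Measure.pi (fun _ => μ) := by
  calc _ = ∫⁻ z, ∫⁻ Z, v z * ((∏ i : Fin m, g i.castSucc (Z i)) *
          g (Fin.last m) (z - ∑ i, Z i)) ∂Measure.pi (fun _ => μ) ∂μ := by
        refine lintegral_congr fun z => ?_
        rw [lintegral_const_mul _ (by fun_prop)]
    _ = ∫⁻ Z, ∫⁻ z, v z * ((∏ i : Fin m, g i.castSucc (Z i)) *
          g (Fin.last m) (z - ∑ i, Z i)) ∂μ ∂Measure.pi (fun _ => μ) := by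
        refine lintegral_lintegral_swap (Measurable.aemeasurable ?_)
        simp only [Function.uncurry_def]
        fun_prop
    _ = _ := by
        rw [lintegral_pi_insertNth (Fin.last m) (by fun_prop)]
        refine lintegral_congr fun Z => ?_
        rw [← lintegral_add_right_eq_self _ (∑ i, Z i)]
        refine lintegral_congr fun z => ?_
        rw [Fin.sum_univ_castSucc, Fin.prod_univ_castSucc]
        simp [Fin.insertNth_last', add_comm]

lemma l2norm_multilinear_conv_le {n α : ℕ} (hn : 2 ≤ n) (hα : 1 ≤ α) {s a b b' c θ : ℝ}
    (hs : 0 ≤ s) (h : InterpolationExponents n α s a b b' c θ) :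
    ∃ C : ℝ≥0∞, C ≠ ∞ ∧ ∀ ε : Fin (α + 1) → ℝ, (∀ i, ε i = 1 ∨ ε i = -1) →
      ∀ F : Fin (α + 1) → (Fin n → ℤ) × ℝ → ℝ≥0∞, (∀ i, Measurable (F i)) →
      l2norm (freqMeasure n) (fun z => ENNReal.ofReal (jbk z.1 ^ s) * modWeight b (modulation 1 z) *
        ∫⁻ Z, (∏ i : Fin α, (freqWeight s (Z i).1 *
            modWeight b (modulation (ε i.castSucc) (Z i)) * F i.castSucc (Z i))) *
          (freqWeight s (z - ∑ i, Z i).1 *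
            modWeight b (modulation (ε (Fin.last α)) (z - ∑ i, Z i)) *
            F (Fin.last α) (z - ∑ i, Z i)) ∂Measure.pi (fun _ => freqMeasure n)) ≤
      C * ∏ i, l2norm (freqMeasure n) (F i) := by
  obtain ⟨C, hC, hform⟩ := lintegral_form_le hn hα hs h
  refine ⟨C, hC, fun ε hε F hF => ?_⟩
  have hmw := measurable_modWeight b
  have hfw := measurable_freqWeight (n := n) s
  have hjb := measurable_jbk_rpow (n := n) s
  set g : Fin (α + 1) → (Fin n → ℤ) × ℝ → ℝ≥0∞ := fun i z =>
    freqWeight s z.1 * modWeight b (modulation (ε i) z) * F i z with hgdef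
  have hg : ∀ i, Measurable (g i) := fun i => by
    have := measurable_modulation (n := n) (ε i)
    fun_prop
  have hw : Measurable fun z : (Fin n → ℤ) × ℝ =>
      ENNReal.ofReal (jbk z.1 ^ s) * modWeight b (modulation 1 z) := by
    have := measurable_modulation (n := n) 1
    fun_prop
  refine l2norm_le_of_forall_lintegral_mul_le
    (hw.mul (measurable_multilinear_conv (μ := freqMeasure n) hg)) fun v hv => ?_
  have hconv := lintegral_mul_multilinear_conv (μ := freqMeasure n) (hv.mul hw) hg
  calc _ = _ := by
        refine (lintegral_congr fun z => ?_).trans hconv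
        exact (mul_assoc _ _ _).symm
    _ = _ := lintegral_congr fun Z => mul_assoc _ _ _
    _ ≤ _ := hform ε hε v F hv hF
    _ = _ := by ring

lemma zero_le_salphan {n α : ℕ} (hn : 2 ≤ n) : 0 ≤ salphan α n := by
  have hn' : (2 : ℝ) ≤ n := by exact_mod_cast hn
  unfold salphan
  split_ifs with h1 h2
  · linarith
  · have : 1 / (4 * ((n : ℝ) - 1)) ≤ 1 / 4 :=
      one_div_le_one_div_of_le (by norm_num) (by linarith)
    linarith
  · obtain rfl | h0 := Nat.eq_zero_or_pos α
    · simp only [CharP.cast_eq_zero, div_zero, sub_zero]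
      linarith
    have h3 : (3 : ℝ) ≤ α := by exact_mod_cast (by omega : 3 ≤ α)
    have : 2 / (α : ℝ) ≤ 1 := by rw [div_le_one (by linarith)]; linarith
    linarith

lemma ofReal_weight_mul {n : ℕ} (r b ε x : ℝ) (k : Fin n → ℤ) (τ : ℝ) :
    ENNReal.ofReal (jbk k ^ (-r) * jb (τ + ε * zn2 k) ^ (-b) * x) =
      freqWeight r k * modWeight b (modulation ε (k, τ)) * ENNReal.ofReal x := by
  have h₁ := jbk_pos k
  have h₂ := jb_pos (τ + ε * zn2 k)
  rw [ENNReal.ofReal_mul (by positivity), ENNReal.ofReal_mul (by positivity)]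
  rfl

lemma ofReal_outputWeight {n : ℕ} (s b : ℝ) (k : Fin n → ℤ) (τ : ℝ) :
    ENNReal.ofReal (jbk k ^ (2 * s) * jb (τ + zn2 k) ^ (-(2 * b))) =
      (ENNReal.ofReal (jbk k ^ s) * modWeight b (modulation 1 (k, τ))) ^ 2 := by
  have h := jbk_pos k
  rw [mul_pow, modWeight_sq, ENNReal.ofReal_mul (by positivity),
    ← ENNReal.ofReal_pow (by positivity), ← Real.rpow_natCast, ← Real.rpow_mul h.le, modWeight,
    modulation, one_mul]
  congr 3
  push_cast
  ring

/-- Proposition 12 (multilinear estimate in Bourgain spaces), stated in Fourier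
variables in `ℝ≥0∞`: for `n ≥ 2`, `α ≥ 1` and `s > s_{α,n}` there are
`b ∈ (0,1/2)` and `C > 0` such that for every choice of signs `ε_i ∈ {±1}` and
nonnegative measurable `f_i`,
`Σ_k ∫ ⟨k⟩^{2s}⟨τ+|k|²⟩^{−2b} (Σ_{k₁+⋯+k_{α+1}=k} ∫_{τ₁+⋯+τ_{α+1}=τ}
∏ᵢ ⟨kᵢ⟩^{−s}⟨τᵢ+εᵢ|kᵢ|²⟩^{−b} fᵢ(kᵢ,τᵢ))² dτ ≤ C ∏ᵢ (Σ_k ∫ fᵢ(k,τ)² dτ)`,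
where the free variables are `(k₁,…,k_α)` and `(τ₁,…,τ_α)`, with
`k_{α+1} = k − Σ kᵢ` and `τ_{α+1} = τ − Σ τᵢ`. -/
theorem stmt5 (n α : ℕ) (hn : 2 ≤ n) (hα : 1 ≤ α) (s : ℝ)
    (hs : salphan α n < s) :
    ∃ b : ℝ, b ∈ Set.Ioo (0 : ℝ) (1 / 2) ∧ ∃ C : ℝ, 0 < C ∧
      ∀ ε : Fin (α + 1) → ℝ, (∀ i, ε i = 1 ∨ ε i = -1) →
      ∀ f : Fin (α + 1) → (Fin n → ℤ) × ℝ → ℝ,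
        (∀ i, Measurable (f i)) → (∀ i z, 0 ≤ f i z) →
        (∑' k : Fin n → ℤ, ∫⁻ τ : ℝ,
            ENNReal.ofReal (jbk k ^ (2 * s) * jb (τ + zn2 k) ^ (-(2 * b))) *
            (∑' K : Fin α → Fin n → ℤ, ∫⁻ τs : Fin α → ℝ,
              (∏ i : Fin α,
                ENNReal.ofReal
                  (jbk (K i) ^ (-s) *
                    jb (τs i + ε i.castSucc * zn2 (K i)) ^ (-b) *
                    f i.castSucc (K i, τs i))) *
              ENNReal.ofReal
                (jbk (k - ∑ j, K j) ^ (-s) *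
                  jb ((τ - ∑ j, τs j) + ε (Fin.last α) * zn2 (k - ∑ j, K j)) ^ (-b) *
                  f (Fin.last α) (k - ∑ j, K j, τ - ∑ j, τs j))) ^ 2)
          ≤ ENNReal.ofReal C *
              ∏ i : Fin (α + 1), ∑' k : Fin n → ℤ, ∫⁻ τ : ℝ,
                ENNReal.ofReal (f i (k, τ)) ^ 2 := by
  obtain ⟨a, b, b', c, θ, h⟩ := exists_interpolationExponents hn hα hs
  have hs0 : 0 ≤ s := (zero_le_salphan hn).trans hs.le
  obtain ⟨C, hC, hest⟩ := l2norm_multilinear_conv_le hn hα hs0 h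
  refine ⟨b, ⟨h.b_pos, h.b_lt⟩, (C ^ 2).toReal + 1, by positivity, fun ε hε f hf _ => ?_⟩
  have hF : ∀ i, Measurable fun z => ENNReal.ofReal (f i z) := fun i => (hf i).ennreal_ofReal
  have hmain := hest ε hε (fun i z => ENNReal.ofReal (f i z)) hF
  rw [l2norm_le_iff, mul_pow, ← Finset.prod_pow] at hmain
  simp_rw [l2norm_sq] at hmain
  have hmw := measurable_modWeight b
  have hfw := measurable_freqWeight (n := n) s
  have hjb := measurable_jbk_rpow (n := n) s
  have hmod := measurable_modulation (n := n)
  have hg : ∀ i, Measurable fun z : (Fin n → ℤ) × ℝ =>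
      freqWeight s z.1 * modWeight b (modulation (ε i) z) * ENNReal.ofReal (f i z) := fun i => by
    have := hmod (ε i)
    fun_prop
  have hw : Measurable fun z : (Fin n → ℤ) × ℝ =>
      ENNReal.ofReal (jbk z.1 ^ s) * modWeight b (modulation 1 z) := by
    have := hmod 1
    fun_prop
  calc _ = _ := by
        refine Eq.symm ((lintegral_freqMeasure
          ((hw.mul (measurable_multilinear_conv (μ := freqMeasure n) hg)).pow_const 2)).trans ?_)
        refine tsum_congr fun k => lintegral_congr fun τ => ?_
        refine (mul_pow _ _ _).trans ?_
        have hsub : ∀ (K : Fin α → Fin n → ℤ) (T : Fin α → ℝ),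
            (k, τ) - ∑ i, (K i, T i) = (k - ∑ i, K i, τ - ∑ i, T i) := fun K T =>
          Prod.ext (by simp [Prod.fst_sum]) (by simp [Prod.snd_sum])
        rw [ofReal_outputWeight]
        refine congrArg (fun t : ℝ≥0∞ => _ * t ^ 2) ?_
        refine (lintegral_pi_count_prod ?_).trans ?_
        · exact (Finset.measurable_prod _ fun i _ =>
            (hg i.castSucc).comp (measurable_pi_apply i)).mul ((hg (Fin.last α)).comp
              (measurable_const.sub (Finset.measurable_sum _ fun i _ => measurable_pi_apply i)))
        · simp only [ofReal_weight_mul, hsub]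
          rfl
    _ ≤ _ := hmain
    _ ≤ _ := by
        gcongr with i
        · rw [ENNReal.ofReal_add (by positivity) (by norm_num),
            ENNReal.ofReal_toReal (by finiteness)]
          exact le_self_add
        · rw [lintegral_freqMeasure (by fun_prop)]
end

section
/- Let γ > 1/2 be a real number. Then there exists a constant C > 0 such that for every λ ∈ ℝ the family ( ⟨λ² − k²⟩^{−γ} )_{k ∈ ℤ} is summable and Σ_{k ∈ ℤ} ⟨λ² − k²⟩^{−γ} ≤ C. -/
theorem sq_shift_le_jb (lam : ℝ) (m : ℤ) (h : |(m : ℝ) - lam| ≤ |(m : ℝ) + lam|) :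
    |((m - ⌊lam⌋ : ℤ) : ℝ) + 1 / 2| ^ 2 / 16 ≤ jb (lam ^ 2 - (m : ℝ) ^ 2) := by
  have hprod : |(m : ℝ) - lam| ^ 2 ≤ |lam ^ 2 - (m : ℝ) ^ 2| := by
    have : lam ^ 2 - (m : ℝ) ^ 2 = -((m - lam) * (m + lam)) := by ring
    rw [this, abs_neg, abs_mul, sq]
    gcongr
  have hshift : |((m - ⌊lam⌋ : ℤ) : ℝ) + 1 / 2| ≤ 2 + |(m : ℝ) - lam| := by
    push_cast
    have h1 := Int.floor_le lam
    have h2 := Int.lt_floor_add_one lam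
    rw [abs_le]
    constructor
    · linarith [neg_abs_le ((m : ℝ) - lam)]
    · linarith [le_abs_self ((m : ℝ) - lam)]
  have hsq : |((m - ⌊lam⌋ : ℤ) : ℝ) + 1 / 2| ^ 2 ≤ 8 + 2 * |lam ^ 2 - (m : ℝ) ^ 2| := by
    calc _ ≤ (2 + |(m : ℝ) - lam|) ^ 2 := by gcongr
      _ ≤ _ := by nlinarith [sq_nonneg (|(m : ℝ) - lam| - 2)]
  apply Real.le_sqrt_of_sq_le
  rw [← sq_abs (lam ^ 2 - (m : ℝ) ^ 2)]
  have hle : |((m - ⌊lam⌋ : ℤ) : ℝ) + 1 / 2| ^ 2 / 16 ≤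
      1 / 2 + |lam ^ 2 - (m : ℝ) ^ 2| / 8 := by linarith
  calc _ ≤ (1 / 2 + |lam ^ 2 - (m : ℝ) ^ 2| / 8) ^ 2 := by gcongr
    _ ≤ _ := by nlinarith [sq_nonneg (|lam ^ 2 - (m : ℝ) ^ 2| - 1)]

theorem jb_rpow_neg_le {γ : ℝ} (hγ : 0 ≤ γ) (lam : ℝ) (m : ℤ)
    (h : |(m : ℝ) - lam| ≤ |(m : ℝ) + lam|) :
    jb (lam ^ 2 - (m : ℝ) ^ 2) ^ (-γ) ≤
      (|((m - ⌊lam⌋ : ℤ) : ℝ) + 1 / 2| ^ 2 / 16) ^ (-γ) := by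
  refine Real.rpow_le_rpow_of_nonpos ?_ (sq_shift_le_jb lam m h) (by linarith)
  have hne : ((m - ⌊lam⌋ : ℤ) : ℝ) + 1 / 2 ≠ 0 := by
    intro h0
    have h1 : 2 * ((m - ⌊lam⌋ : ℤ) : ℝ) + 1 = 0 := by linarith
    have h2 : 2 * (m - ⌊lam⌋) + 1 = 0 := by exact_mod_cast h1
    omega
  positivity

theorem summable_sq_shift_rpow {γ : ℝ} (hγ : 1 / 2 < γ) :
    Summable fun m : ℤ => (|(m : ℝ) + 1 / 2| ^ 2 / 16) ^ (-γ) := by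
  have hs := (Real.summable_one_div_int_add_rpow (1 / 2) (2 * γ)).2 (by linarith)
  refine (hs.mul_right ((16 : ℝ) ^ (-γ))⁻¹).congr fun m => ?_
  rw [Real.div_rpow (by positivity) (by norm_num), ← Real.rpow_natCast, ← Real.rpow_mul
    (abs_nonneg _), one_div, ← Real.rpow_neg (abs_nonneg _), div_eq_mul_inv]
  congr 2
  push_cast
  ring

/-- Claim 3: for `γ > 1/2`, the sums `Σ_{k ∈ ℤ} ⟨λ² − k²⟩^{−γ}` are bounded
uniformly in `λ ∈ ℝ`. -/
theorem stmt7 (γ : ℝ) (hγ : 1 / 2 < γ) :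
    ∃ C : ℝ, 0 < C ∧ ∀ lam : ℝ,
      Summable (fun m : ℤ => jb (lam ^ 2 - (m : ℝ) ^ 2) ^ (-γ)) ∧
      ∑' m : ℤ, jb (lam ^ 2 - (m : ℝ) ^ 2) ^ (-γ) ≤ C := by
  set H : ℤ → ℝ := fun m => (|(m : ℝ) + 1 / 2| ^ 2 / 16) ^ (-γ)
  have hsum : Summable H := summable_sq_shift_rpow hγ
  have hpos (m : ℤ) : 0 ≤ H m := by positivity
  have htsum : 0 ≤ ∑' m, H m := tsum_nonneg hpos
  refine ⟨∑' m, H m + ∑' m, H m + 1, by linarith, fun lam => ?_⟩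
  have hshift (n : ℤ) : Summable fun m => H (m - n) :=
    hsum.comp_injective (Equiv.subRight n).injective
  have heq (n : ℤ) : ∑' m, H (m - n) = ∑' m, H m := (Equiv.subRight n).tsum_eq H
  have hle (m : ℤ) : jb (lam ^ 2 - (m : ℝ) ^ 2) ^ (-γ) ≤ H (m - ⌊lam⌋) + H (m - ⌊-lam⌋) := by
    rcases le_total |(m : ℝ) - lam| |(m : ℝ) + lam| with h | h
    · exact (jb_rpow_neg_le (by linarith) lam m h).trans (le_add_of_nonneg_right (hpos _))
    · have h' := jb_rpow_neg_le (γ := γ) (by linarith) (-lam) m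
        (by simpa [← sub_eq_add_neg] using h)
      rw [neg_sq] at h'
      exact h'.trans (le_add_of_nonneg_left (hpos _))
  have hbound := (hshift ⌊lam⌋).add (hshift ⌊-lam⌋)
  have hsummable : Summable fun m : ℤ => jb (lam ^ 2 - (m : ℝ) ^ 2) ^ (-γ) :=
    hbound.of_nonneg_of_le (fun m => Real.rpow_nonneg (Real.sqrt_nonneg _) _) hle
  refine ⟨hsummable, ?_⟩
  have := hsummable.tsum_le_tsum hle hbound
  rw [(hshift _).tsum_add (hshift _), heq, heq] at this
  linarith
end

section
/- Let s and δ be real numbers with s ≥ −1, 0 < δ < 1/2 and s + 2δ < 1/2. Then there exists a constant C > 0 such that for every real λ ≥ 1: Σ_{k ∈ ℕ*, |k² − λ²| ≥ 1} k^{2s+2} |k² − λ²|^{2δ − 2} ≤ C λ^{2s+2}. -/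
/-- The sequence `(1 + |j|) ^ p` is summable over the integers when `p < -1`. -/
theorem summable_one_add_abs_int_rpow {p : ℝ} (hp : p < -1) :
    Summable fun j : ℤ => (1 + |(j : ℝ)|) ^ p := by
  have h : Summable fun n : ℕ => (1 + (n : ℝ)) ^ p := by
    have := (summable_nat_add_iff 1).2 (Real.summable_nat_rpow.2 hp)
    simpa [add_comm] using this
  exact Summable.of_nat_of_neg (by simpa using h) (by simpa using h)

/-- Away from the resonance, each term of the sum is controlled by a translate of a summable
sequence over `ℤ` and a summable sequence over `ℕ`. -/
theorem rpow_mul_abs_sq_sub_sq_rpow_le {a b x lam : ℝ} {n : ℤ} (ha : 0 ≤ a) (hb : 0 ≤ b)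
    (hlam : 1 ≤ lam) (hx : 1 ≤ x) (hn : |lam - n| ≤ 1) (hres : 1 ≤ |x ^ 2 - lam ^ 2|) :
    x ^ a * |x ^ 2 - lam ^ 2| ^ (-b) ≤
      lam ^ a * (2 ^ a * 3 ^ b) * (1 + |x - n|) ^ (-b) + lam ^ a * 2 ^ b * x ^ (a - 2 * b) := by
  have hx0 : 0 < x := by linarith
  have hl0 : 0 < lam := by linarith
  have hy : 0 < 1 + |x - n| := by positivity
  rcases le_total x (2 * lam) with h | h
  · have h1 : x ^ a ≤ 2 ^ a * lam ^ a := by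
      rw [← Real.mul_rpow (by norm_num) hl0.le]
      exact Real.rpow_le_rpow hx0.le h ha
    have h2 : (1 + |x - n|) / 3 ≤ |x ^ 2 - lam ^ 2| := by
      have e : |x ^ 2 - lam ^ 2| = |x - lam| * (x + lam) := by
        rw [show x ^ 2 - lam ^ 2 = (x - lam) * (x + lam) by ring, abs_mul,
          abs_of_pos (by linarith : 0 < x + lam)]
      have e1 : |x - lam| ≤ |x ^ 2 - lam ^ 2| := by
        rw [e]
        exact le_mul_of_one_le_right (abs_nonneg _) (by linarith)
      have e2 : |x - n| ≤ |x - lam| + |lam - n| := abs_sub_le _ _ _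
      linarith
    have h3 : |x ^ 2 - lam ^ 2| ^ (-b) ≤ 3 ^ b * (1 + |x - n|) ^ (-b) := by
      refine (Real.rpow_le_rpow_of_nonpos (by positivity) h2 (by linarith)).trans_eq ?_
      rw [Real.div_rpow hy.le (by norm_num), Real.rpow_neg (by norm_num : (0 : ℝ) ≤ 3),
        div_inv_eq_mul, mul_comm]
    calc x ^ a * |x ^ 2 - lam ^ 2| ^ (-b)
        ≤ (2 ^ a * lam ^ a) * (3 ^ b * (1 + |x - n|) ^ (-b)) := by gcongr
      _ = lam ^ a * (2 ^ a * 3 ^ b) * (1 + |x - n|) ^ (-b) := by ring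
      _ ≤ _ := le_add_of_nonneg_right (by positivity)
  · have h2 : x ^ 2 / 2 ≤ |x ^ 2 - lam ^ 2| := le_trans (by nlinarith) (le_abs_self _)
    have h3 : |x ^ 2 - lam ^ 2| ^ (-b) ≤ 2 ^ b * x ^ (-(2 * b)) := by
      refine (Real.rpow_le_rpow_of_nonpos (by positivity) h2 (by linarith)).trans_eq ?_
      rw [Real.div_rpow (by positivity) (by norm_num), Real.rpow_neg (by norm_num : (0 : ℝ) ≤ 2),
        div_inv_eq_mul, mul_comm, ← Real.rpow_natCast, ← Real.rpow_mul hx0.le]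
      norm_num
    calc x ^ a * |x ^ 2 - lam ^ 2| ^ (-b) ≤ x ^ a * (2 ^ b * x ^ (-(2 * b))) := by gcongr
      _ = 1 * 2 ^ b * x ^ (a - 2 * b) := by rw [sub_eq_add_neg, Real.rpow_add hx0]; ring
      _ ≤ lam ^ a * 2 ^ b * x ^ (a - 2 * b) := by gcongr; exact Real.one_le_rpow hlam ha
      _ ≤ _ := le_add_of_nonneg_left (by positivity)

/-- Pulling a summable nonnegative sequence back along an injection and scaling it by a constant
gives a sum bounded by the scaled original sum. -/
theorem tsum_ofReal_mul_comp_le {ι κ : Type*} {f : κ → ℝ} (hf : Summable f) (hf0 : ∀ j, 0 ≤ f j)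
    {g : ι → κ} (hg : Function.Injective g) {c : ℝ} (hc : 0 ≤ c) :
    ∑' i, ENNReal.ofReal (c * f (g i)) ≤ ENNReal.ofReal (c * ∑' j, f j) := by
  rw [← tsum_mul_left, ENNReal.ofReal_tsum_of_nonneg (fun j => mul_nonneg hc (hf0 j))
    (hf.mul_left c)]
  exact ENNReal.tsum_comp_le_tsum_of_injective hg fun j => ENNReal.ofReal (c * f j)

/-- For `s ≥ −1`, `0 < δ < 1/2`, `s + 2δ < 1/2`:
`Σ_{k ≥ 1, |k²−λ²| ≥ 1} k^{2s+2} |k²−λ²|^{2δ−2} ≤ C λ^{2s+2}` for all `λ ≥ 1`.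
(Stated in `ℝ≥0∞` so that the inequality also asserts summability.) -/
theorem stmt14 (s δ : ℝ) (hs : -1 ≤ s) (hδ0 : 0 < δ) (hδ : δ < 1 / 2)
    (hsδ : s + 2 * δ < 1 / 2) :
    ∃ C : ℝ, 0 < C ∧ ∀ lam : ℝ, 1 ≤ lam →
      ∑' k : {k : ℕ+ // 1 ≤ |(k : ℝ) ^ 2 - lam ^ 2|},
          ENNReal.ofReal
            ((k.1 : ℝ) ^ (2 * s + 2) * |(k.1 : ℝ) ^ 2 - lam ^ 2| ^ (2 * δ - 2))
        ≤ ENNReal.ofReal (C * lam ^ (2 * s + 2)) := by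
  obtain ⟨a, ha⟩ : ∃ a, a = 2 * s + 2 := ⟨_, rfl⟩
  obtain ⟨b, hb⟩ : ∃ b, b = 2 - 2 * δ := ⟨_, rfl⟩
  rw [← ha, show 2 * δ - 2 = -b by linarith]
  have hF := summable_one_add_abs_int_rpow (p := -b) (by linarith)
  have hF0 (j : ℤ) : 0 ≤ (1 + |(j : ℝ)|) ^ (-b) := by positivity
  have hG : Summable fun n : ℕ => (n : ℝ) ^ (a - 2 * b) :=
    Real.summable_nat_rpow.2 (by linarith)
  have hG0 (n : ℕ) : 0 ≤ (n : ℝ) ^ (a - 2 * b) := by positivity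
  have hSF : 0 ≤ ∑' j : ℤ, (1 + |(j : ℝ)|) ^ (-b) := tsum_nonneg hF0
  have hSG : 0 ≤ ∑' n : ℕ, (n : ℝ) ^ (a - 2 * b) := tsum_nonneg hG0
  refine ⟨2 ^ a * 3 ^ b * (∑' j : ℤ, (1 + |(j : ℝ)|) ^ (-b)) +
    2 ^ b * (∑' n : ℕ, (n : ℝ) ^ (a - 2 * b)) + 1, by positivity, fun lam hlam => ?_⟩
  have hn : |lam - ⌊lam⌋| ≤ 1 := by
    rw [Int.self_sub_floor, abs_of_nonneg (Int.fract_nonneg _)]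
    exact (Int.fract_lt_one _).le
  have hla : 0 ≤ lam ^ a := by positivity
  let g (k : {k : ℕ+ // 1 ≤ |(k : ℝ) ^ 2 - lam ^ 2|}) : ℤ := ((k.1 : ℕ) : ℤ) - ⌊lam⌋
  let h (k : {k : ℕ+ // 1 ≤ |(k : ℝ) ^ 2 - lam ^ 2|}) : ℕ := (k.1 : ℕ)
  have hh : Function.Injective h := PNat.coe_injective.comp Subtype.val_injective
  have hg : Function.Injective g := fun k l hkl => hh (by simpa [g, h] using hkl)
  calc _ ≤ ∑' k, (ENNReal.ofReal (lam ^ a * (2 ^ a * 3 ^ b) * (1 + |(g k : ℝ)|) ^ (-b)) +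
          ENNReal.ofReal (lam ^ a * 2 ^ b * (h k : ℝ) ^ (a - 2 * b))) := by
        refine ENNReal.tsum_le_tsum fun k => ?_
        rw [← ENNReal.ofReal_add (by positivity) (by positivity)]
        refine ENNReal.ofReal_le_ofReal ?_
        have hk : (1 : ℝ) ≤ ((k.1 : ℕ) : ℝ) := by exact_mod_cast k.1.pos
        simpa [g, h] using rpow_mul_abs_sq_sub_sq_rpow_le (a := a) (b := b) (by linarith)
          (by linarith) hlam hk hn k.2
    _ ≤ ENNReal.ofReal (lam ^ a * (2 ^ a * 3 ^ b) * ∑' j : ℤ, (1 + |(j : ℝ)|) ^ (-b)) +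
          ENNReal.ofReal (lam ^ a * 2 ^ b * ∑' n : ℕ, (n : ℝ) ^ (a - 2 * b)) := by
        rw [ENNReal.tsum_add]
        exact add_le_add (tsum_ofReal_mul_comp_le hF hF0 hg (by positivity))
          (tsum_ofReal_mul_comp_le hG hG0 hh (by positivity))
    _ ≤ _ := by
        rw [← ENNReal.ofReal_add (by positivity) (by positivity)]
        exact ENNReal.ofReal_le_ofReal (by linarith)
end

section
/- Let n ≥ 2 and let g : ℝ^{n−1} → ℝ be a C^∞ function such that for every j ∈ {1,…,n−1}, every m ∈ ℕ, and every point x ∈ [0,π]^{n−1} whose j-th coordinate x_j belongs to {0, π}, the odd-order partial derivative ∂^{2m+1} g / ∂x_j^{2m+1}(x) equals 0. Then for every K ∈ ℕ there exists a constant C_K > 0 such that for all p = (p₁,…,p_{n−1}) and q = (q₁,…,q_{n−1}) in (ℕ*)^{n−1}: | ∫_{[0,π]^{n−1}} g(x) ∏_{j=1}^{n−1} sin(p_j x_j) sin(q_j x_j) dx | ≤ C_K ∏_{j=1}^{n−1} ⟨p_j − q_j⟩^{−K}. -/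
open MeasureTheory

open scoped ContDiff

/-- The partial derivative of `f` in the `j`-th coordinate. -/
noncomputable def pd {d : ℕ} (j : Fin d) (f : (Fin d → ℝ) → ℝ) (x : Fin d → ℝ) : ℝ :=
  fderiv ℝ f x (Pi.single j 1)

/-- The cube `[0, π]^d`. -/
def piCube (d : ℕ) : Set (Fin d → ℝ) := Set.Icc 0 (fun _ => Real.pi)

lemma mem_piCube {d : ℕ} {x : Fin d → ℝ} :
    x ∈ piCube d ↔ ∀ i, x i ∈ Set.Icc 0 Real.pi := by
  simp only [piCube, Set.mem_Icc, Pi.le_def, Pi.zero_apply]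
  exact forall_and.symm

lemma isCompact_piCube (d : ℕ) : IsCompact (piCube d) := isCompact_Icc

lemma update_mem_piCube {d : ℕ} {x : Fin d → ℝ} (hx : x ∈ piCube d) (j : Fin d) {y : ℝ}
    (hy : y ∈ Set.Icc 0 Real.pi) : Function.update x j y ∈ piCube d := by
  rw [mem_piCube] at hx ⊢
  intro i
  rcases eq_or_ne i j with rfl | h
  · simpa using hy
  · simpa [Function.update_of_ne h] using hx i

lemma ContDiff.pd {d : ℕ} {f : (Fin d → ℝ) → ℝ} (hf : ContDiff ℝ ∞ f) (j : Fin d) :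
    ContDiff ℝ ∞ (pd j f) :=
  (hf.fderiv_right (m := ∞) (by simp)).clm_apply contDiff_const

lemma ContDiff.pd_iterate {d : ℕ} {f : (Fin d → ℝ) → ℝ} (hf : ContDiff ℝ ∞ f) (j : Fin d)
    (k : ℕ) : ContDiff ℝ ∞ ((_root_.pd j)^[k] f) := by
  induction k with
  | zero => exact hf
  | succ k ih => rw [Function.iterate_succ_apply']; exact ih.pd j

lemma ContDiff.hasDerivAt_update_pd {d : ℕ} {f : (Fin d → ℝ) → ℝ} (hf : ContDiff ℝ ∞ f)
    (j : Fin d) (x : Fin d → ℝ) (y : ℝ) :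
    HasDerivAt (fun y => f (Function.update x j y)) (_root_.pd j f (Function.update x j y)) y :=
  ((hf.differentiable (by simp)) (Function.update x j y)).hasFDerivAt.comp_hasDerivAt y
    (hasDerivAt_update x j y)

lemma ContDiff.pd_eq_of_hasDerivAt {d : ℕ} {f : (Fin d → ℝ) → ℝ} (hf : ContDiff ℝ ∞ f)
    (j : Fin d) (x : Fin d → ℝ) {c : ℝ}
    (h : HasDerivAt (fun y => f (Function.update x j y)) c (x j)) : _root_.pd j f x = c := by
  have := hf.hasDerivAt_update_pd j x (x j)
  rw [Function.update_eq_self] at this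
  exact this.unique h

lemma ContDiff.iteratedDeriv_update {d : ℕ} {f : (Fin d → ℝ) → ℝ} (hf : ContDiff ℝ ∞ f)
    (j : Fin d) (x : Fin d → ℝ) (k : ℕ) :
    iteratedDeriv k (fun y => f (Function.update x j y)) =
      fun y => (_root_.pd j)^[k] f (Function.update x j y) := by
  induction k with
  | zero => simp
  | succ k ih =>
    rw [iteratedDeriv_succ, ih]
    funext y
    rw [((hf.pd_iterate j k).hasDerivAt_update_pd j x y).deriv, Function.iterate_succ_apply']

lemma ContDiff.pd_sub {d : ℕ} {f g : (Fin d → ℝ) → ℝ} (hf : ContDiff ℝ ∞ f)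
    (hg : ContDiff ℝ ∞ g) (j : Fin d) :
    _root_.pd j (fun x => f x - g x) = fun x => _root_.pd j f x - _root_.pd j g x := by
  funext x
  have h1 := (hf.differentiable (by simp)) x
  have h2 := (hg.differentiable (by simp)) x
  simp only [_root_.pd, fderiv_fun_sub h1 h2, sub_apply]

lemma ContDiff.pd_iterate_sub {d : ℕ} {f g : (Fin d → ℝ) → ℝ} (hf : ContDiff ℝ ∞ f)
    (hg : ContDiff ℝ ∞ g) (j : Fin d) (k : ℕ) :
    (_root_.pd j)^[k] (fun x => f x - g x) =
      fun x => (_root_.pd j)^[k] f x - (_root_.pd j)^[k] g x := by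
  induction k with
  | zero => rfl
  | succ k ih =>
    simp only [Function.iterate_succ_apply', ih]
    exact (hf.pd_iterate j k).pd_sub (hg.pd_iterate j k) j

lemma ContDiff.pd_comm {d : ℕ} {f : (Fin d → ℝ) → ℝ} (hf : ContDiff ℝ ∞ f) (i j : Fin d) :
    _root_.pd i (_root_.pd j f) = _root_.pd j (_root_.pd i f) := by
  have hd : Differentiable ℝ (fderiv ℝ f) :=
    (hf.fderiv_right (m := ∞) (by simp)).differentiable (by simp)
  have key : ∀ (a b : Fin d) (x : Fin d → ℝ), _root_.pd a (_root_.pd b f) x =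
      fderiv ℝ (fderiv ℝ f) x (Pi.single a 1) (Pi.single b 1) := by
    intro a b x
    have h := ((hd x).hasFDerivAt.clm_apply
      (hasFDerivAt_const (Pi.single b (1 : ℝ) : Fin d → ℝ) x)).fderiv
    unfold _root_.pd
    rw [h]
    simp
  funext x
  rw [key, key]
  refine ((hf.contDiffAt (x := x)).isSymmSndFDerivAt ?_).eq _ _
  rw [minSmoothness_of_isRCLikeNormedField]
  exact WithTop.coe_le_coe.2 (le_top : (2 : ℕ∞) ≤ ⊤)

lemma ContDiff.pd_iterate_comm {d : ℕ} {f : (Fin d → ℝ) → ℝ} (hf : ContDiff ℝ ∞ f)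
    (i j : Fin d) (k : ℕ) :
    (_root_.pd i)^[k] (_root_.pd j f) = _root_.pd j ((_root_.pd i)^[k] f) := by
  induction k with
  | zero => rfl
  | succ k ih =>
    rw [Function.iterate_succ_apply', ih, (hf.pd_iterate i k).pd_comm,
      Function.iterate_succ_apply']

/-- Smooth functions all of whose odd-order derivatives normal to the faces of `[0, π]^d`
vanish on those faces. -/
structure IsDirichletController {d : ℕ} (f : (Fin d → ℝ) → ℝ) : Prop where
  contDiff : ContDiff ℝ ∞ f
  pd_odd : ∀ (j : Fin d) (m : ℕ), ∀ x ∈ piCube d, (x j = 0 ∨ x j = Real.pi) →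
    (pd j)^[2 * m + 1] f x = 0

/-- If a smooth function vanishes on the faces normal to `e i`, then so do its tangential
derivatives. -/
lemma pd_eq_zero_of_face {d : ℕ} {f : (Fin d → ℝ) → ℝ} (hf : ContDiff ℝ ∞ f) {i j : Fin d}
    (hij : i ≠ j) (h : ∀ x ∈ piCube d, (x i = 0 ∨ x i = Real.pi) → f x = 0) :
    ∀ x ∈ piCube d, (x i = 0 ∨ x i = Real.pi) → pd j f x = 0 := by
  intro x hx hxi
  have hxj := mem_piCube.1 hx j
  have h1 := (hf.hasDerivAt_update_pd j x (x j)).hasDerivWithinAt (s := Set.Icc 0 Real.pi)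
  rw [Function.update_eq_self] at h1
  have h0 : ∀ y ∈ Set.Icc 0 Real.pi, f (Function.update x j y) = 0 := fun y hy =>
    h _ (update_mem_piCube hx j hy) (by simpa [Function.update_of_ne hij] using hxi)
  have h2 : HasDerivWithinAt (fun y => f (Function.update x j y)) 0 (Set.Icc 0 Real.pi) (x j) :=
    (hasDerivWithinAt_const (x j) _ (0 : ℝ)).congr h0 (h0 _ hxj)
  exact (uniqueDiffOn_Icc Real.pi_pos (x j) hxj).eq_deriv _ h1 h2

lemma IsDirichletController.sub {d : ℕ} {f g : (Fin d → ℝ) → ℝ} (hf : IsDirichletController f)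
    (hg : IsDirichletController g) : IsDirichletController (fun x => f x - g x) where
  contDiff := hf.contDiff.sub hg.contDiff
  pd_odd j m x hx hxj := by
    rw [hf.contDiff.pd_iterate_sub hg.contDiff]
    simp only [hf.pd_odd j m x hx hxj, hg.pd_odd j m x hx hxj, sub_zero]

lemma IsDirichletController.pd_pd {d : ℕ} {f : (Fin d → ℝ) → ℝ} (hf : IsDirichletController f)
    (j : Fin d) : IsDirichletController (pd j (pd j f)) where
  contDiff := (hf.contDiff.pd j).pd j
  pd_odd i m := by
    rcases eq_or_ne i j with rfl | hij
    · have := hf.pd_odd i (m + 1)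
      rwa [show 2 * (m + 1) + 1 = (2 * m + 1).succ.succ by omega, Function.iterate_succ_apply,
        Function.iterate_succ_apply] at this
    · rw [(hf.contDiff.pd j).pd_iterate_comm, hf.contDiff.pd_iterate_comm]
      have hs := hf.contDiff.pd_iterate i (2 * m + 1)
      exact pd_eq_zero_of_face (hs.pd j) hij (pd_eq_zero_of_face hs hij (hf.pd_odd i m))

/-- The integral of a partial derivative of a function vanishing on the two corresponding faces
is zero. -/
lemma integral_pd_eq_zero {d : ℕ} (j : Fin (d + 1)) {f : (Fin (d + 1) → ℝ) → ℝ}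
    (hf : ContDiff ℝ ∞ f)
    (h : ∀ x ∈ piCube (d + 1), (x j = 0 ∨ x j = Real.pi) → f x = 0) :
    ∫ x in piCube (d + 1), pd j f x = 0 := by
  have hsum : ∀ x, ∑ i, (if i = j then fderiv ℝ f else 0) x (Pi.single i 1) = pd j f x := by
    intro x
    rw [Finset.sum_eq_single j]
    · simp [pd]
    · intro i _ hi
      simp [hi]
    · simp
  have key := integral_divergence_of_hasFDerivAt_off_countable' (E := ℝ)
    (0 : Fin (d + 1) → ℝ) (fun _ => Real.pi) (fun _ => Real.pi_pos.le)
    (fun i => if i = j then f else 0) (fun i => if i = j then fderiv ℝ f else 0) ∅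
    Set.countable_empty
    (fun i => by
      split_ifs
      · exact hf.continuous.continuousOn
      · exact continuousOn_const)
    (fun x _ i => by
      split_ifs
      · exact ((hf.differentiable (by simp)) x).hasFDerivAt
      · exact hasFDerivAt_const _ _)
    (by
      simp only [hsum]
      exact (hf.pd j).continuous.continuousOn.integrableOn_compact (isCompact_piCube _))
  simp only [hsum] at key
  refine key.trans (Finset.sum_eq_zero fun i _ => ?_)
  rcases eq_or_ne i j with rfl | hij
  · have hmem : ∀ x ∈ Set.Icc ((0 : Fin (d + 1) → ℝ) ∘ i.succAbove)
        ((fun _ => Real.pi) ∘ i.succAbove), ∀ c ∈ Set.Icc 0 Real.pi,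
        (Fin.insertNth i c x : Fin (d + 1) → ℝ) ∈ piCube (d + 1) := by
      intro x hx c hc
      rw [mem_piCube, Fin.forall_iff_succAbove i]
      refine ⟨by simpa using hc, fun k => ?_⟩
      rw [Fin.insertNth_apply_succAbove]
      exact ⟨hx.1 k, hx.2 k⟩
    rw [setIntegral_eq_zero_of_forall_eq_zero, setIntegral_eq_zero_of_forall_eq_zero, sub_zero]
    · intro x hx
      simp only [if_true]
      exact h _ (hmem x hx _ ⟨le_rfl, Real.pi_pos.le⟩) (Or.inl (by simp))
    · intro x hx
      simp only [if_true]
      exact h _ (hmem x hx _ ⟨Real.pi_pos.le, le_rfl⟩) (Or.inr (by simp))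
  · simp [hij]

/-- The product of cosines `∏ j, cos (m j * x j)`. -/
noncomputable def cosProd {d : ℕ} (m : Fin d → ℤ) (x : Fin d → ℝ) : ℝ :=
  ∏ j, Real.cos (m j * x j)

lemma continuous_cosProd {d : ℕ} (m : Fin d → ℤ) : Continuous (cosProd m) := by
  unfold cosProd
  fun_prop

lemma abs_cosProd_le_one {d : ℕ} (m : Fin d → ℤ) (x : Fin d → ℝ) : |cosProd m x| ≤ 1 := by
  rw [cosProd, Finset.abs_prod]
  exact Finset.prod_le_one (fun _ _ => abs_nonneg _) fun _ _ => Real.abs_cos_le_one _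

/-- Two integrations by parts against a product of cosines. -/
lemma IsDirichletController.integral_sub_pd_pd {d : ℕ} {f : (Fin (d + 1) → ℝ) → ℝ}
    (hf : IsDirichletController f) (j : Fin (d + 1)) (m : Fin (d + 1) → ℤ) :
    ∫ x in piCube (d + 1), (f x - pd j (pd j f) x) * cosProd m x =
      (1 + (m j : ℝ) ^ 2) * ∫ x in piCube (d + 1), f x * cosProd m x := by
  set R : (Fin (d + 1) → ℝ) → ℝ := fun x => ∏ i ∈ Finset.univ.erase j, Real.cos (m i * x i)
  have hcos : ∀ x, cosProd m x = Real.cos (m j * x j) * R x := fun x =>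
    (Finset.mul_prod_erase Finset.univ (fun i => Real.cos (m i * x i)) (Finset.mem_univ j)).symm
  have hRs : ContDiff ℝ ∞ R := by
    refine contDiff_prod fun i _ => ?_
    fun_prop
  have hRu : ∀ x y, R (Function.update x j y) = R x := by
    intro x y
    refine Finset.prod_congr rfl fun i hi => ?_
    rw [Function.update_of_ne (Finset.ne_of_mem_erase hi)]
  have hfs := hf.contDiff
  have hf1 := hfs.pd j
  set G : (Fin (d + 1) → ℝ) → ℝ := fun x =>
    (pd j f x * Real.cos (m j * x j) + f x * (m j * Real.sin (m j * x j))) * R x with hG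
  have hGs : ContDiff ℝ ∞ G := by
    rw [hG]
    fun_prop
  have hGpd : ∀ x, pd j G x = (pd j (pd j f) x + (m j : ℝ) ^ 2 * f x) * cosProd m x := by
    intro x
    apply hGs.pd_eq_of_hasDerivAt
    have e0 := hfs.hasDerivAt_update_pd j x (x j)
    have e1 := hf1.hasDerivAt_update_pd j x (x j)
    have e2 : HasDerivAt (fun y : ℝ => (m j : ℝ) * y) (m j : ℝ) (x j) := by
      simpa using (hasDerivAt_id (x j)).const_mul (m j : ℝ)
    have e3 := (((e1.mul e2.cos).add (e0.mul (e2.sin.const_mul (m j : ℝ)))).mul_const (R x))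
    have hfun : (fun y => G (Function.update x j y)) = fun y =>
        (pd j f (Function.update x j y) * Real.cos (m j * y) +
          f (Function.update x j y) * (m j * Real.sin (m j * y))) * R x := by
      funext y
      simp only [hG, hRu, Function.update_self]
    rw [hfun]
    refine e3.congr_deriv ?_
    simp only [Function.update_eq_self, hcos]
    ring
  have hG0 : ∀ x ∈ piCube (d + 1), (x j = 0 ∨ x j = Real.pi) → G x = 0 := by
    intro x hx hxj
    have h1 : pd j f x = 0 := hf.pd_odd j 0 x hx hxj
    have h2 : Real.sin (m j * x j) = 0 := by
      rcases hxj with h | h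
      · simp [h]
      · rw [h, Real.sin_int_mul_pi]
    simp only [hG, h1, h2]
    ring
  have hint : ∀ h : (Fin (d + 1) → ℝ) → ℝ, Continuous h → IntegrableOn h (piCube (d + 1)) :=
    fun h hh => hh.continuousOn.integrableOn_compact (isCompact_piCube _)
  have hc := continuous_cosProd m
  have hz := integral_pd_eq_zero j hGs hG0
  have e : ∀ x, (f x - pd j (pd j f) x) * cosProd m x =
      (1 + (m j : ℝ) ^ 2) * (f x * cosProd m x) - pd j G x := by
    intro x
    rw [hGpd]
    ring
  simp only [e]
  rw [integral_sub, hz, sub_zero, integral_const_mul]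
  · exact hint _ (continuous_const.mul (hfs.continuous.mul hc))
  · exact hint _ (hGs.pd j).continuous

lemma IsDirichletController.exists_integral_eq_pow {d : ℕ} {f : (Fin (d + 1) → ℝ) → ℝ}
    (hf : IsDirichletController f) (j : Fin (d + 1)) (K : ℕ) :
    ∃ h, IsDirichletController h ∧ ∀ m : Fin (d + 1) → ℤ,
      ∫ x in piCube (d + 1), h x * cosProd m x =
        (1 + (m j : ℝ) ^ 2) ^ K * ∫ x in piCube (d + 1), f x * cosProd m x := by
  induction K with
  | zero => exact ⟨f, hf, by simp⟩
  | succ K ih =>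
    obtain ⟨h, hh, hm⟩ := ih
    refine ⟨_, hh.sub (hh.pd_pd j), fun m => ?_⟩
    rw [hh.integral_sub_pd_pd, hm]
    ring

lemma IsDirichletController.exists_integral_eq_prod {d : ℕ} {f : (Fin (d + 1) → ℝ) → ℝ}
    (hf : IsDirichletController f) (K : ℕ) (s : Finset (Fin (d + 1))) :
    ∃ h, IsDirichletController h ∧ ∀ m : Fin (d + 1) → ℤ,
      ∫ x in piCube (d + 1), h x * cosProd m x =
        (∏ j ∈ s, (1 + (m j : ℝ) ^ 2) ^ K) * ∫ x in piCube (d + 1), f x * cosProd m x := by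
  induction s using Finset.induction_on with
  | empty => exact ⟨f, hf, by simp⟩
  | insert j s hj ih =>
    obtain ⟨h, hh, hm⟩ := ih
    obtain ⟨h', hh', hm'⟩ := hh.exists_integral_eq_pow j K
    refine ⟨h', hh', fun m => ?_⟩
    rw [hm', hm, Finset.prod_insert hj, mul_assoc]

/-- The cosine coefficients of a Dirichlet controller decay rapidly. -/
lemma IsDirichletController.exists_cosProd_bound {d : ℕ} {f : (Fin (d + 1) → ℝ) → ℝ}
    (hf : IsDirichletController f) (K : ℕ) :
    ∃ C, 0 < C ∧ ∀ m : Fin (d + 1) → ℤ,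
      (∏ j, (1 + (m j : ℝ) ^ 2) ^ K) * |∫ x in piCube (d + 1), f x * cosProd m x| ≤ C := by
  obtain ⟨h, hh, hm⟩ := hf.exists_integral_eq_prod K Finset.univ
  obtain ⟨M, hM⟩ := (isCompact_piCube (d + 1)).exists_bound_of_continuousOn
    hh.contDiff.continuous.continuousOn
  refine ⟨|M * volume.real (piCube (d + 1))| + 1, by positivity, fun m => ?_⟩
  have hb : ‖∫ x in piCube (d + 1), h x * cosProd m x‖ ≤ M * volume.real (piCube (d + 1)) := by
    refine norm_setIntegral_le_of_norm_le_const (isCompact_piCube _).measure_lt_top fun x hx => ?_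
    rw [norm_mul]
    calc ‖h x‖ * ‖cosProd m x‖ ≤ ‖h x‖ * 1 := by
          gcongr
          exact abs_cosProd_le_one m x
      _ ≤ M := by rw [mul_one]; exact hM x hx
  rw [hm, norm_mul, Real.norm_eq_abs, Real.norm_eq_abs, abs_of_nonneg (by positivity)] at hb
  linarith [le_abs_self (M * volume.real (piCube (d + 1)))]

lemma jb_rpow_neg_le_s16 {a : ℝ} {b : ℝ} (h : a ^ 2 ≤ b ^ 2) (K : ℕ) :
    ((1 + b ^ 2) ^ K)⁻¹ ≤ jb a ^ (-(K : ℝ)) := by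
  have h1 : 1 ≤ jb a := Real.one_le_sqrt.2 (by nlinarith [sq_nonneg a])
  have h2 : jb a ^ 2 = 1 + a ^ 2 := Real.sq_sqrt (by positivity)
  rw [Real.rpow_neg (by linarith), Real.rpow_natCast]
  apply inv_anti₀ (by positivity)
  apply pow_le_pow_left₀ (by linarith)
  nlinarith

/-- The frequency `p - q` or `p + q`, according to the sign. -/
def signedFreq (p q : ℤ) : Bool → ℤ
  | true => p - q
  | false => p + q

lemma sin_mul_sin_eq_sum (p q : ℤ) (x : ℝ) :
    Real.sin (p * x) * Real.sin (q * x) =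
      ∑ b : Bool, (bif b then 1 / 2 else -1 / 2) * Real.cos (signedFreq p q b * x) := by
  simp only [Fintype.sum_bool, signedFreq, cond_true, cond_false, Int.cast_sub, Int.cast_add,
    sub_mul, add_mul, Real.cos_sub, Real.cos_add]
  ring

lemma IsDirichletController.exists_sin_bound {d : ℕ} {f : (Fin (d + 1) → ℝ) → ℝ}
    (hf : IsDirichletController f) (K : ℕ) :
    ∃ C, 0 < C ∧ ∀ p q : Fin (d + 1) → ℤ, (∀ j, 0 ≤ p j) → (∀ j, 0 ≤ q j) →
      |∫ x in piCube (d + 1), f x * ∏ j, (Real.sin (p j * x j) * Real.sin (q j * x j))|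
        ≤ C * ∏ j, jb ((p j : ℝ) - q j) ^ (-(K : ℝ)) := by
  obtain ⟨C, hC, hb⟩ := hf.exists_cosProd_bound K
  refine ⟨Fintype.card (Fin (d + 1) → Bool) * C, by positivity, fun p q hp hq => ?_⟩
  set c : (Fin (d + 1) → Bool) → ℝ := fun ε => ∏ j, (bif ε j then 1 / 2 else -1 / 2)
  have hc : ∀ ε, |c ε| ≤ 1 := by
    intro ε
    rw [Finset.abs_prod]
    refine Finset.prod_le_one (fun _ _ => abs_nonneg _) fun j _ => ?_
    cases ε j <;> norm_num [abs_le]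
  set μ : (Fin (d + 1) → Bool) → Fin (d + 1) → ℤ := fun ε j => signedFreq (p j) (q j) (ε j)
  have hexp : ∀ x : Fin (d + 1) → ℝ,
      f x * ∏ j, (Real.sin (p j * x j) * Real.sin (q j * x j)) =
        ∑ ε, c ε * (f x * cosProd (μ ε) x) := by
    intro x
    simp only [sin_mul_sin_eq_sum]
    rw [Finset.prod_univ_sum, Fintype.piFinset_univ, Finset.mul_sum]
    refine Finset.sum_congr rfl fun ε _ => ?_
    rw [Finset.prod_mul_distrib, cosProd]
    ring
  have hterm : ∀ ε, |∫ x in piCube (d + 1), f x * cosProd (μ ε) x| ≤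
      C * ∏ j, jb ((p j : ℝ) - q j) ^ (-(K : ℝ)) := by
    intro ε
    have hpos : 0 < ∏ j, (1 + (μ ε j : ℝ) ^ 2) ^ K := by positivity
    have h1 : |∫ x in piCube (d + 1), f x * cosProd (μ ε) x| ≤
        C * (∏ j, (1 + (μ ε j : ℝ) ^ 2) ^ K)⁻¹ := by
      rw [← div_eq_mul_inv, le_div_iff₀ hpos, mul_comm]
      exact hb (μ ε)
    refine h1.trans ?_
    rw [← Finset.prod_inv_distrib]
    gcongr with j _
    apply jb_rpow_neg_le_s16
    have hp' : (0 : ℝ) ≤ p j := by exact_mod_cast hp j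
    have hq' : (0 : ℝ) ≤ q j := by exact_mod_cast hq j
    simp only [μ]
    cases ε j <;> simp only [signedFreq, Int.cast_add, Int.cast_sub] <;> nlinarith
  simp only [hexp]
  rw [integral_finsetSum]
  · refine (Finset.abs_sum_le_sum_abs _ _).trans ?_
    rw [mul_assoc, ← nsmul_eq_mul, Fintype.card]
    refine Finset.sum_le_card_nsmul _ _ _ fun ε _ => ?_
    rw [integral_const_mul, abs_mul]
    calc _ ≤ 1 * |∫ x in piCube (d + 1), f x * cosProd (μ ε) x| := by
          gcongr
          exact hc ε
      _ ≤ _ := by rw [one_mul]; exact hterm ε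
  · intro ε _
    exact (continuous_const.mul (hf.contDiff.continuous.mul
      (continuous_cosProd _))).continuousOn.integrableOn_compact (isCompact_piCube _)

/-- Rapid off-diagonal decay of the face integrals: if `g` is `C^∞` on `ℝ^{n−1}`
and all its odd-order coordinate derivatives vanish at points of `[0,π]^{n−1}`
lying on a face `x_j ∈ {0, π}`, then for every `K` there is `C_K` with
`|∫_{[0,π]^{n−1}} g(x) ∏_j sin(p_j x_j) sin(q_j x_j) dx| ≤ C_K ∏_j ⟨p_j−q_j⟩^{−K}`. -/
theorem stmt16 (n : ℕ) (hn : 2 ≤ n) (g : (Fin (n - 1) → ℝ) → ℝ)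
    (hg : ContDiff ℝ (⊤ : ℕ∞) g)
    (hodd : ∀ j : Fin (n - 1), ∀ m : ℕ, ∀ x : Fin (n - 1) → ℝ,
      (∀ i, x i ∈ Set.Icc 0 Real.pi) → (x j = 0 ∨ x j = Real.pi) →
      iteratedDeriv (2 * m + 1) (fun y => g (Function.update x j y)) (x j) = 0) :
    ∀ K : ℕ, ∃ C : ℝ, 0 < C ∧ ∀ p q : Fin (n - 1) → ℕ+,
      |∫ x in {x : Fin (n - 1) → ℝ | ∀ i, x i ∈ Set.Icc 0 Real.pi},
          g x * ∏ j, (Real.sin ((p j : ℝ) * x j) * Real.sin ((q j : ℝ) * x j))|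
        ≤ C * ∏ j, jb ((p j : ℝ) - (q j : ℝ)) ^ (-(K : ℝ)) := by
  obtain ⟨d, rfl⟩ : ∃ d, n = d + 2 := ⟨n - 2, by omega⟩
  have hctrl : IsDirichletController (d := d + 1) g := by
    refine ⟨hg, fun j m x hx hxj => ?_⟩
    have h := hodd j m x (mem_piCube.1 hx) hxj
    rw [ContDiff.iteratedDeriv_update (d := d + 1) hg j x] at h
    simpa only [Function.update_eq_self] using h
  intro K
  obtain ⟨C, hC, hb⟩ := hctrl.exists_sin_bound K
  refine ⟨C, hC, fun p q => ?_⟩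
  have hset : {x : Fin (d + 1) → ℝ | ∀ i, x i ∈ Set.Icc 0 Real.pi} = piCube (d + 1) :=
    Set.ext fun _ => mem_piCube.symm
  have h := hb (fun j => ((p j : ℕ) : ℤ)) (fun j => ((q j : ℕ) : ℤ))
    (fun _ => Int.natCast_nonneg _) (fun _ => Int.natCast_nonneg _)
  rw [← hset] at h
  simp only [Int.cast_natCast] at h
  exact h
end

section
/- Let s and b be real numbers with s + 2b ≥ 1/2, and let p be a positive integer. Then the series Σ_{q = p+1}^∞ (q² − p²)^{2b−2} q^{2s+2} diverges, i.e. the family ((q² − p²)^{2b−2} q^{2s+2})_{q > p} is not summable. -/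
theorem Real.min_one_rpow_mul_rpow_le {c x y : ℝ} (e : ℝ) (hc : 0 < c) (hy : 0 < y)
    (hcx : c * y ≤ x) (hxy : x ≤ y) : min 1 (c ^ e) * y ^ e ≤ x ^ e := by
  have hye : 0 ≤ y ^ e := Real.rpow_nonneg hy.le e
  have hx : 0 < x := (mul_pos hc hy).trans_le hcx
  rcases le_total 0 e with he | he
  · calc min 1 (c ^ e) * y ^ e ≤ c ^ e * y ^ e := by gcongr; exact min_le_right _ _
      _ = (c * y) ^ e := (Real.mul_rpow hc.le hy.le).symm
      _ ≤ x ^ e := Real.rpow_le_rpow (mul_pos hc hy).le hcx he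
  · calc min 1 (c ^ e) * y ^ e ≤ 1 * y ^ e := by gcongr; exact min_le_left _ _
      _ = y ^ e := one_mul _
      _ ≤ x ^ e := Real.rpow_le_rpow_of_nonpos hx hxy he

theorem PNat.not_summable_inv_gt (p : ℕ+) :
    ¬ Summable (fun q : {q : ℕ+ // p < q} => (q.1 : ℝ)⁻¹) := by
  intro hs
  let f : ℕ → {q : ℕ+ // p < q} := fun n =>
    ⟨(n + p : ℕ).succPNat, PNat.coe_lt_coe _ _ |>.1 (by rw [Nat.succPNat_coe]; omega)⟩
  have hf : Function.Injective f := fun m n hmn =>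
    Nat.add_right_cancel (Nat.succPNat_injective (congrArg Subtype.val hmn))
  have hcomp : Summable fun n : ℕ => (((n + (p + 1) : ℕ) : ℝ))⁻¹ := by
    refine (hs.comp_injective hf).congr fun n => ?_
    simp [f, add_assoc]
  exact Real.not_summable_natCast_inv
    ((summable_nat_add_iff (f := fun n : ℕ => (n : ℝ)⁻¹) ((p : ℕ) + 1)).1 hcomp)

/-- Sharpness of the condition `s + 2b < 1/2`: if `s + 2b ≥ 1/2`, the series
`Σ_{q > p} (q² − p²)^{2b−2} q^{2s+2}` diverges. -/
theorem stmt19 (s b : ℝ) (h : 1 / 2 ≤ s + 2 * b) (p : ℕ+) :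
    ¬ Summable (fun q : {q : ℕ+ // p < q} =>
        ((q.1 : ℝ) ^ 2 - (p : ℝ) ^ 2) ^ (2 * b - 2) * (q.1 : ℝ) ^ (2 * s + 2)) := by
  intro hs
  set c : ℝ := (((p : ℝ) + 1) ^ 2)⁻¹ with hc_def
  have hp : (0 : ℝ) < p := by exact_mod_cast p.pos
  have hc : 0 < c := by positivity
  set K : ℝ := min 1 (c ^ (2 * b - 2))
  have hK : 0 < K := lt_min one_pos (Real.rpow_pos_of_pos hc _)
  refine PNat.not_summable_inv_gt p ((summable_mul_left_iff hK.ne').1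
    (hs.of_nonneg_of_le (fun q => by positivity) fun q => ?_))
  have hpq : (p : ℝ) + 1 ≤ q.1 := by exact_mod_cast q.2
  have hq1 : (1 : ℝ) ≤ q.1 := by linarith
  have hq : (0 : ℝ) < q.1 := by linarith
  have hlower : c * (q.1 : ℝ) ^ 2 ≤ (q.1 : ℝ) ^ 2 - (p : ℝ) ^ 2 := by
    rw [hc_def, inv_mul_le_iff₀ (by positivity)]
    nlinarith [mul_nonneg (show (0 : ℝ) ≤ (p : ℝ) ^ 2 + 2 * p by positivity)
      (sub_nonneg.2 (pow_le_pow_left₀ (by positivity) hpq 2)),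
      mul_pos hp (pow_pos (add_pos hp one_pos) 2)]
  calc K * (q.1 : ℝ)⁻¹ ≤ K * ((q.1 : ℝ) ^ 2) ^ (2 * b - 2) * (q.1 : ℝ) ^ (2 * s + 2) := by
        rw [mul_assoc, ← Real.rpow_natCast_mul hq.le, ← Real.rpow_add hq, ← Real.rpow_neg_one]
        refine mul_le_mul_of_nonneg_left (Real.rpow_le_rpow_of_exponent_le hq1 ?_) hK.le
        push_cast
        linarith
    _ ≤ _ := by
        gcongr
        exact Real.min_one_rpow_mul_rpow_le _ hc (by positivity) hlower
          (sub_le_self _ (sq_nonneg _))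
end
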